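/- arXiv:2408.14903 — 3 statements merged into one kernel-verified Lean document; each statement's English description precedes it below -/
import Mathlib

section
/- Let φ: X → ℝ be bounded measurable, assume (A1), (A2) and (A7), assume the adaptation has the stochastic-approximation form S_k = S_{k−1} + γ_k H_k, and suppose (i) Σ_{k≥1} (γ_k/k^{1/2}) E[‖H_k‖] < ∞ and (ii) S_k → s_∞ ∈ S almost surely. Then the central limit theorem holds: n^{−1/2} Σ_{k=1}^n (φ(X_k) − π(φ)) converges in distribution to N(0, σ_φ²) with asymptotic variance σ_φ² = π(g_{s_∞}² − (P_{s_∞} g_{s_∞})²) ∈ [0,∞), where g_s(x) = Σ_{k=0}^∞ (P_s^k φ̄)(x). -/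
open MeasureTheory Filter Finset ProbabilityTheory
open scoped ENNReal NNReal Topology

/-- Total variation distance between two measures: `sup_A |μ(A) - ν(A)|`. -/
noncomputable def tvDist {X : Type*} [MeasurableSpace X] (μ ν : Measure X) : ℝ :=
  ⨆ A : {A : Set X // MeasurableSet A}, |(μ A.1).toReal - (ν A.1).toReal|

/-- `iterK P s k x` is the `k`-step transition probability `P_s^k(x, ·)`. -/
noncomputable def iterK {S X : Type*} [MeasurableSpace X]
    (P : S → X → Measure X) (s : S) : ℕ → X → Measure X
  | 0 => fun x => Measure.dirac x
  | n + 1 => fun x => (P s x).bind (iterK P s n)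

/-- Supremum norm `‖f‖_∞ = sup_x |f x|`. -/
noncomputable def supNorm {X : Type*} (f : X → ℝ) : ℝ := ⨆ x, |f x|

/-- Oscillation `osc(f) = sup_x f x - inf_x f x`. -/
noncomputable def osc {X : Type*} (f : X → ℝ) : ℝ := (⨆ x, f x) - (⨅ x, f x)

/-- The solution of the Poisson equation: `g_s x = Σ_{k=0}^∞ (P_s^k φ̄)(x)`
where `φ̄ = φ - π(φ)`. -/
noncomputable def gfun {S X : Type*} [MeasurableSpace X]
    (P : S → X → Measure X) (π : Measure X) (φ : X → ℝ) (s : S) (x : X) : ℝ :=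
  ∑' k : ℕ, ∫ y, (φ y - ∫ z, φ z ∂π) ∂(iterK P s k x)

/-- `Pg P π φ s x = (P_s g_s)(x)`. -/
noncomputable def Pg {S X : Type*} [MeasurableSpace X]
    (P : S → X → Measure X) (π : Measure X) (φ : X → ℝ) (s : S) (x : X) : ℝ :=
  ∫ y, gfun P π φ s y ∂(P s x)


set_option linter.unusedSectionVars false
set_option linter.unusedVariables false

namespace AdaptCLT

/-- Bounded measurable functions. -/
structure BM {X : Type*} [MeasurableSpace X] (f : X → ℝ) (B : ℝ) : Prop where
  meas : Measurable f
  bound : ∀ x, |f x| ≤ B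

/-- The standing hypotheses on the kernels. -/
structure Setup {E X : Type*} [MeasurableSpace E] [MeasurableSpace X]
    (P : E → X → Measure X) (π : Measure X) (C ρ : ℝ) : Prop where
  hπ : IsProbabilityMeasure π
  prob : ∀ s x, IsProbabilityMeasure (P s x)
  meas : ∀ A : Set X, MeasurableSet A → Measurable fun p : E × X => P p.1 p.2 A
  inv : ∀ s, π.bind (P s) = π
  hρ : ρ ∈ Set.Ico (0 : ℝ) 1
  hC : 0 ≤ C
  tv : ∀ s x k, tvDist (iterK P s k x) π ≤ C * ρ ^ k

theorem BM.integrable {X : Type*} [MeasurableSpace X] {f : X → ℝ} {B : ℝ} (h : BM f B)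
    (m : Measure X) [IsFiniteMeasure m] : Integrable f m :=
  Integrable.of_bound h.meas.aestronglyMeasurable B (ae_of_all _ h.bound)

theorem BM.abs_integral_le {X : Type*} [MeasurableSpace X] {f : X → ℝ} {B : ℝ} (h : BM f B)
    (m : Measure X) [IsProbabilityMeasure m] : |∫ x, f x ∂m| ≤ B := by
  have := norm_integral_le_of_norm_le_const (μ := m) (f := f) (C := B) (ae_of_all _ h.bound)
  simpa using this

theorem tv_bdd {X : Type*} [MeasurableSpace X] (m m' : Measure X) [IsProbabilityMeasure m]
    [IsProbabilityMeasure m'] (A : Set X) (hA : MeasurableSet A) :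
    |(m A).toReal - (m' A).toReal| ≤ tvDist m m' := by
  unfold tvDist
  refine le_ciSup (f := fun A : {A : Set X // MeasurableSet A} =>
    |(m A.1).toReal - (m' A.1).toReal|) ⟨1, ?_⟩ ⟨A, hA⟩
  rintro _ ⟨B, rfl⟩
  have h1 : (m B.1).toReal ≤ 1 := measureReal_le_one (μ := m)
  have h2 : (m' B.1).toReal ≤ 1 := measureReal_le_one (μ := m')
  have h3 : 0 ≤ (m B.1).toReal := ENNReal.toReal_nonneg
  have h4 : 0 ≤ (m' B.1).toReal := ENNReal.toReal_nonneg
  simp only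
  rw [abs_le]; constructor <;> linarith

theorem tv_nonneg {X : Type*} [MeasurableSpace X] (m m' : Measure X) : 0 ≤ tvDist m m' :=
  Real.iSup_nonneg fun _ => abs_nonneg _

theorem tv_integral {X : Type*} [MeasurableSpace X] (m m' : Measure X) [IsProbabilityMeasure m]
    [IsProbabilityMeasure m'] {f : X → ℝ} {B : ℝ} (h : BM f B) :
    |∫ x, f x ∂m - ∫ x, f x ∂m'| ≤ 2 * B * tvDist m m' := by
  have hne : Nonempty X := by
    by_contra hX
    rw [not_nonempty_iff] at hX
    have : m Set.univ = 1 := measure_univ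
    rw [Set.univ_eq_empty_iff.2 hX] at this
    simp at this
  have hB : 0 ≤ B := (abs_nonneg _).trans (h.bound hne.some)
  have key : ∀ (n : Measure X) [IsProbabilityMeasure n],
      ∫ x, f x ∂n = (∫ t in Set.Ioc 0 (2 * B), n.real {a | t ≤ f a + B}) - B := by
    intro n _
    rw [← Integrable.integral_eq_integral_Ioc_meas_le (μ := n) (f := fun a => f a + B)
      (M := 2 * B)]
    · rw [integral_add (h.integrable n) (integrable_const _)]; simp
    · exact (h.integrable n).add (integrable_const _)
    · exact ae_of_all _ fun x => by have := abs_le.1 (h.bound x); simp; linarith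
    · exact ae_of_all _ fun x => by have := abs_le.1 (h.bound x); simp; linarith
  have hintg : ∀ (n : Measure X) [IsProbabilityMeasure n],
      Integrable (fun t => n.real {a | t ≤ f a + B}) (volume.restrict (Set.Ioc 0 (2 * B))) := by
    intro n _
    refine Integrable.of_bound ?_ 1 (ae_of_all _ fun t => ?_)
    · refine (Antitone.measurable ?_).aestronglyMeasurable
      intro t t' htt
      exact measureReal_mono fun a (ha : t' ≤ _) => htt.trans ha
    · rw [Real.norm_of_nonneg measureReal_nonneg]; exact measureReal_le_one
  rw [key m, key m', sub_sub_sub_cancel_right, ← integral_sub (hintg m) (hintg m')]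
  have := norm_setIntegral_le_of_norm_le_const (μ := volume) (s := Set.Ioc 0 (2 * B))
    (f := fun t => m.real {a | t ≤ f a + B} - m'.real {a | t ≤ f a + B}) (C := tvDist m m')
    measure_Ioc_lt_top (fun t _ => tv_bdd m m' _ (measurableSet_le measurable_const
      (h.meas.add measurable_const)))
  simp only [Real.norm_eq_abs, measureReal_def, Real.volume_Ioc, sub_zero] at this
  rw [ENNReal.toReal_ofReal (by linarith)] at this
  simp only [measureReal_def]
  linarith

theorem integral_bind' {X : Type*} [MeasurableSpace X] (m : Measure X) [IsProbabilityMeasure m]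
    (κ : X → Measure X) (hκ : Measurable κ) (hp : ∀ x, IsProbabilityMeasure (κ x))
    {f : X → ℝ} {B : ℝ} (h : BM f B) :
    ∫ x, f x ∂(m.bind κ) = ∫ x, ∫ y, f y ∂(κ x) ∂m := by
  let K : Kernel X X := ⟨κ, hκ⟩
  have : IsMarkovKernel K := ⟨hp⟩
  have : IsProbabilityMeasure (K ∘ₘ m) := inferInstance
  have h2 : (K ∘ₖ (Kernel.const Unit m)) () = m.bind κ := by
    rw [Kernel.comp_apply, Kernel.const_apply]; rfl
  have h3 := Kernel.integral_comp (η := K) (κ := Kernel.const Unit m) (a := ()) (f := f)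
    (by rw [h2]; exact h.integrable (K ∘ₘ m))
  rw [h2] at h3
  exact h3

section
variable {E X : Type*} [MeasurableSpace E] [MeasurableSpace X]
    {P : E → X → Measure X} {π : Measure X} {C ρ : ℝ}

theorem Setup.measJ (h : Setup P π C ρ) : Measurable fun p : E × X => P p.1 p.2 :=
  Measure.measurable_of_measurable_coe _ h.meas

theorem Setup.measP (h : Setup P π C ρ) (s : E) : Measurable (P s) :=
  h.measJ.comp measurable_prodMk_left

theorem Setup.iterJ (h : Setup P π C ρ) (k : ℕ) :
    (Measurable fun p : E × X => iterK P p.1 k p.2) ∧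
      ∀ s x, IsProbabilityMeasure (iterK P s k x) := by
  induction k with
  | zero =>
    constructor
    · exact Measure.measurable_dirac.comp measurable_snd
    · intro s x; exact Measure.dirac.isProbabilityMeasure
  | succ k ih =>
    have hm : ∀ s, Measurable (iterK P s k) := fun s => ih.1.comp measurable_prodMk_left
    constructor
    · refine Measure.measurable_of_measurable_coe _ fun A hA => ?_
      let K : Kernel (E × X) X := ⟨_, h.measJ⟩
      have : IsMarkovKernel K := ⟨fun p => h.prob p.1 p.2⟩
      have : (fun p : E × X => iterK P p.1 (k+1) p.2 A)
          = fun p => ∫⁻ y, iterK P p.1 k y A ∂(K p) := by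
        funext p
        exact Measure.bind_apply hA (hm _).aemeasurable
      rw [this]
      refine Measurable.lintegral_kernel_prod_right (κ := K)
        (f := fun p y => iterK P p.1 k y A) ?_
      exact (Measure.measurable_coe hA).comp (ih.1.comp
        ((measurable_fst.comp measurable_fst).prodMk measurable_snd))
    · intro s x
      have := h.prob s x
      let K : Kernel X X := ⟨_, hm s⟩
      have : IsMarkovKernel K := ⟨fun p => ih.2 s p⟩
      exact (inferInstance : IsProbabilityMeasure (K ∘ₘ (P s x)))

/-- `(P_s^k f)(x)`. -/
noncomputable def Q (P : E → X → Measure X) (s : E) (k : ℕ) (f : X → ℝ) (x : X) : ℝ :=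
  ∫ y, f y ∂(iterK P s k x)

theorem Setup.Q_measJ (h : Setup P π C ρ) (k : ℕ) {f : E × X → ℝ} (hf : Measurable f) :
    Measurable fun p : E × X => Q P p.1 k (fun y => f (p.1, y)) p.2 := by
  let K : Kernel (E × X) X := ⟨_, (h.iterJ k).1⟩
  have : IsMarkovKernel K := ⟨fun p => (h.iterJ k).2 p.1 p.2⟩
  refine (StronglyMeasurable.integral_kernel_prod_right (κ := K)
    (f := fun p y => f (p.1, y)) ?_).measurable
  exact (hf.comp ((measurable_fst.comp measurable_fst).prodMk measurable_snd)).stronglyMeasurable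

theorem Setup.P_measJ (h : Setup P π C ρ) {f : E × X → ℝ} (hf : Measurable f) :
    Measurable fun p : E × X => ∫ y, f (p.1, y) ∂(P p.1 p.2) := by
  let K : Kernel (E × X) X := ⟨_, h.measJ⟩
  have : IsMarkovKernel K := ⟨fun p => h.prob p.1 p.2⟩
  refine (StronglyMeasurable.integral_kernel_prod_right (κ := K)
    (f := fun p y => f (p.1, y)) ?_).measurable
  exact (hf.comp ((measurable_fst.comp measurable_fst).prodMk measurable_snd)).stronglyMeasurable

theorem Setup.P_BM (h : Setup P π C ρ) (s : E) {f : X → ℝ} {B : ℝ} (hf : BM f B) :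
    BM (fun x => ∫ y, f y ∂(P s x)) B := by
  refine ⟨(h.P_measJ (f := fun p => f p.2) (hf.meas.comp measurable_snd)).comp
    (measurable_prodMk_left (x := s)), fun x => ?_⟩
  have := h.prob s x
  exact hf.abs_integral_le _

theorem Setup.Q_BM (h : Setup P π C ρ) (s : E) (k : ℕ) {f : X → ℝ} {B : ℝ} (hf : BM f B) :
    BM (Q P s k f) B := by
  refine ⟨(h.Q_measJ k (f := fun p => f p.2) (hf.meas.comp measurable_snd)).comp
    (measurable_prodMk_left (x := s)), fun x => ?_⟩
  have := (h.iterJ k).2 s x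
  exact hf.abs_integral_le _

theorem Setup.Q_zero (s : E) {f : X → ℝ} {B : ℝ} (hf : BM f B) (x : X) : Q P s 0 f x = f x := by
  simp only [Q, iterK]
  exact integral_dirac' f x hf.meas.stronglyMeasurable

theorem Setup.Q_succ (h : Setup P π C ρ) (s : E) (k : ℕ) {f : X → ℝ} {B : ℝ} (hf : BM f B)
    (x : X) : Q P s (k + 1) f x = ∫ y, Q P s k f y ∂(P s x) := by
  have := h.prob s x
  exact integral_bind' _ _ ((h.iterJ k).1.comp measurable_prodMk_left) ((h.iterJ k).2 s) hf

/-- `P^{k+1} f = P^k (P f)`. -/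
theorem Setup.Q_succ' (h : Setup P π C ρ) (s : E) (k : ℕ) {f : X → ℝ} {B : ℝ} (hf : BM f B)
    (x : X) : Q P s (k + 1) f x = Q P s k (fun z => ∫ y, f y ∂(P s z)) x := by
  induction k generalizing x with
  | zero =>
    rw [h.Q_succ s 0 hf, Setup.Q_zero s (h.P_BM s hf)]
    simp_rw [Setup.Q_zero s hf]
  | succ k ih =>
    rw [h.Q_succ s (k+1) hf, h.Q_succ s k (h.P_BM s hf)]
    simp_rw [ih]

theorem Setup.inv_integral (h : Setup P π C ρ) (s : E) {f : X → ℝ} {B : ℝ} (hf : BM f B) :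
    ∫ x, ∫ y, f y ∂(P s x) ∂π = ∫ x, f x ∂π := by
  have := h.hπ
  conv_rhs => rw [← h.inv s]
  exact (integral_bind' _ _ (h.measP s) (h.prob s) hf).symm

theorem Setup.Q_conv (h : Setup P π C ρ) (s : E) (k : ℕ) {f : X → ℝ} {B : ℝ} (hf : BM f B)
    (x : X) : |Q P s k f x - ∫ y, f y ∂π| ≤ 2 * B * C * ρ ^ k := by
  have := h.hπ
  have := (h.iterJ k).2 s x
  have hB : 0 ≤ B := (abs_nonneg _).trans (hf.bound x)
  refine (tv_integral _ _ hf).trans ?_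
  have := h.tv s x k
  calc _ ≤ 2 * B * (C * ρ ^ k) := by gcongr
    _ = _ := by ring

theorem Setup.Q_conv0 (h : Setup P π C ρ) (s : E) (k : ℕ) {f : X → ℝ} {B : ℝ} (hf : BM f B)
    (h0 : ∫ y, f y ∂π = 0) (x : X) : |Q P s k f x| ≤ 2 * B * C * ρ ^ k := by
  have := h.Q_conv s k hf x
  rwa [h0, sub_zero] at this

theorem Setup.Q_tendsto (h : Setup P π C ρ) (s : E) {f : X → ℝ} {B : ℝ} (hf : BM f B)
    (x : X) : Tendsto (fun k => Q P s k f x) atTop (𝓝 (∫ y, f y ∂π)) := by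
  rw [tendsto_iff_norm_sub_tendsto_zero]
  refine squeeze_zero (fun _ => norm_nonneg _) (fun k => h.Q_conv s k hf x) ?_
  simpa using (tendsto_pow_atTop_nhds_zero_of_lt_one h.hρ.1 h.hρ.2).const_mul (2 * B * C)

theorem Setup.geom (h : Setup P π C ρ) (B : ℝ) :
    HasSum (fun k => 2 * B * C * ρ ^ k) (2 * B * C / (1 - ρ)) := by
  simpa [div_eq_mul_inv] using (hasSum_geometric_of_lt_one h.hρ.1 h.hρ.2).mul_left (2 * B * C)

/-- If `w - P_s w = r` then `w = ∑_{j<N} P^j r + P^N w`. -/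
theorem Setup.telescope (h : Setup P π C ρ) (s : E) {w r : X → ℝ} {B B' : ℝ} (hw : BM w B)
    (hr : BM r B') (he : ∀ x, w x - ∫ y, w y ∂(P s x) = r x) (N : ℕ) (x : X) :
    w x = ∑ j ∈ Finset.range N, Q P s j r x + Q P s N w x := by
  induction N with
  | zero => simp [Setup.Q_zero s hw]
  | succ N ih =>
    rw [Finset.sum_range_succ, h.Q_succ' s N hw]
    have : Q P s N r x = Q P s N w x - Q P s N (fun z => ∫ y, w y ∂(P s z)) x := by
      have := (h.iterJ N).2 s x
      simp only [Q]
      rw [← integral_sub (hw.integrable _) ((h.P_BM s hw).integrable _)]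
      simp_rw [he]
    rw [this]; linarith

/-- Resolvent bound: if `w - P_s w = r`, `π w = 0` then `w` is controlled by `r`. -/
theorem Setup.resolvent (h : Setup P π C ρ) (s : E) {w r : X → ℝ} {B B' : ℝ} (hw : BM w B)
    (hr : BM r B') (he : ∀ x, w x - ∫ y, w y ∂(P s x) = r x) (h0 : ∫ x, w x ∂π = 0) (x : X) :
    |w x| ≤ 2 * B' * C / (1 - ρ) := by
  have := h.hπ
  have hr0 : ∫ x, r x ∂π = 0 := by
    simp_rw [← he]
    rw [integral_sub (hw.integrable _) ((h.P_BM s hw).integrable _), h.inv_integral s hw, sub_self]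
  have hs : ∀ N, |∑ j ∈ Finset.range N, Q P s j r x| ≤ 2 * B' * C / (1 - ρ) := by
    intro N
    refine (Finset.abs_sum_le_sum_abs _ _).trans ?_
    refine (Finset.sum_le_sum fun j _ => h.Q_conv0 s j hr hr0 x).trans ?_
    refine sum_le_hasSum _ (fun i _ => ?_) (h.geom B')
    have hB : 0 ≤ B' := (abs_nonneg _).trans (hr.bound x)
    have := h.hC; have := h.hρ.1
    positivity
  have ht : Tendsto (fun N => |w x - Q P s N w x|) atTop (𝓝 |w x - 0|) :=
    (tendsto_const_nhds.sub (h0 ▸ h.Q_tendsto s hw x)).abs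
  rw [sub_zero] at ht
  refine le_of_tendsto' ht fun N => ?_
  have := h.telescope s hw hr he N x
  rw [show w x - Q P s N w x = ∑ j ∈ Finset.range N, Q P s j r x by linarith]
  exact hs N

theorem Setup.centered (h : Setup P π C ρ) {φ : X → ℝ} {B : ℝ} (hφ : BM φ B) :
    BM (fun y => φ y - ∫ z, φ z ∂π) (2 * B) ∧ ∫ y, (φ y - ∫ z, φ z ∂π) ∂π = 0 := by
  have := h.hπ
  refine ⟨⟨hφ.meas.sub_const _, fun x => ?_⟩, ?_⟩
  · have h1 := abs_le.1 (hφ.bound x)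
    have h2 := abs_le.1 (hφ.abs_integral_le π)
    rw [abs_le]; constructor <;> linarith [h1.1, h1.2, h2.1, h2.2]
  · rw [integral_sub (hφ.integrable _) (integrable_const _)]; simp

theorem Setup.g_hasSum (h : Setup P π C ρ) {φ : X → ℝ} {B : ℝ} (hφ : BM φ B) (s : E) (x : X) :
    HasSum (fun k => Q P s k (fun y => φ y - ∫ z, φ z ∂π) x) (gfun P π φ s x) := by
  have hc := h.centered hφ
  refine Summable.hasSum (f := fun k => Q P s k (fun y => φ y - ∫ z, φ z ∂π) x) ?_
  exact Summable.of_norm_bounded (h.geom (2 * B)).summable fun k => h.Q_conv0 s k hc.1 hc.2 x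

theorem Setup.g_measJ (h : Setup P π C ρ) {φ : X → ℝ} {B : ℝ} (hφ : BM φ B) :
    Measurable fun p : E × X => gfun P π φ p.1 p.2 := by
  refine measurable_of_tendsto_metrizable (f := fun N (p : E × X) => ∑ k ∈ Finset.range N,
    Q P p.1 k (fun y => φ y - ∫ z, φ z ∂π) p.2) (fun N => ?_)
    (tendsto_pi_nhds.2 fun p => (h.g_hasSum hφ p.1 p.2).tendsto_sum_nat)
  refine Finset.measurable_sum _ fun k _ => ?_
  exact h.Q_measJ k (f := fun p => φ p.2 - ∫ z, φ z ∂π) ((hφ.meas.comp measurable_snd).sub_const _)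

theorem Setup.g_BM (h : Setup P π C ρ) {φ : X → ℝ} {B : ℝ} (hφ : BM φ B) (s : E) :
    BM (gfun P π φ s) (2 * (2 * B) * C / (1 - ρ)) := by
  refine ⟨(h.g_measJ hφ).comp (measurable_prodMk_left (x := s)), fun x => ?_⟩
  have hc := h.centered hφ
  rw [← (h.g_hasSum hφ s x).tsum_eq]
  exact tsum_of_norm_bounded (f := fun k => Q P s k (fun y => φ y - ∫ z, φ z ∂π) x)
    (h.geom (2 * B)) fun k => h.Q_conv0 s k hc.1 hc.2 x

/-- Poisson equation. -/
theorem Setup.poisson (h : Setup P π C ρ) {φ : X → ℝ} {B : ℝ} (hφ : BM φ B) (s : E) (x : X) :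
    gfun P π φ s x - Pg P π φ s x = φ x - ∫ z, φ z ∂π := by
  have hc := h.centered hφ
  have := h.prob s x
  have h1 := h.g_hasSum hφ s x
  have h2 : HasSum (fun k => Q P s (k + 1) (fun y => φ y - ∫ z, φ z ∂π) x) (Pg P π φ s x) := by
    have := hasSum_integral_of_summable_integral_norm (μ := P s x)
      (F := fun k y => Q P s k (fun y => φ y - ∫ z, φ z ∂π) y)
      (fun k => (h.Q_BM s k hc.1).integrable _) ?_
    · simp_rw [h.Q_succ s _ hc.1]
      exact this
    · refine Summable.of_nonneg_of_le (fun k => by positivity) (fun k => ?_)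
        (h.geom (2 * B)).summable
      have hb : BM (fun y => ‖Q P s k (fun y => φ y - ∫ z, φ z ∂π) y‖)
          (2 * (2 * B) * C * ρ ^ k) :=
        ⟨(h.Q_BM s k hc.1).meas.norm, fun y => by
          rw [abs_of_nonneg (norm_nonneg _)]; exact h.Q_conv0 s k hc.1 hc.2 y⟩
      exact (le_abs_self _).trans (hb.abs_integral_le _)
  have h3 := (hasSum_nat_add_iff' 1).2 h1
  have := h3.unique h2
  simp [Setup.Q_zero s hc.1] at this
  linarith

theorem Setup.g_mean (h : Setup P π C ρ) {φ : X → ℝ} {B : ℝ} (hφ : BM φ B) (s : E) :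
    ∫ x, gfun P π φ s x ∂π = 0 := by
  have := h.hπ
  have hne : Nonempty X := by
    by_contra hX
    rw [not_nonempty_iff] at hX
    have : π Set.univ = 1 := measure_univ
    rw [Set.univ_eq_empty_iff.2 hX] at this
    simp at this
  obtain ⟨x⟩ := hne
  have h1 := h.Q_tendsto s (h.g_BM hφ s) x
  have h2 : Tendsto (fun N => gfun P π φ s x -
      ∑ k ∈ Finset.range N, Q P s k (fun y => φ y - ∫ z, φ z ∂π) x) atTop (𝓝 0) := by
    simpa using (tendsto_const_nhds (x := gfun P π φ s x)).sub (h.g_hasSum hφ s x).tendsto_sum_nat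
  refine tendsto_nhds_unique h1 (h2.congr fun N => ?_)
  have := h.telescope s (h.g_BM hφ s) (h.centered hφ).1 (fun x => h.poisson hφ s x) N x
  linarith

end

end AdaptCLT

namespace AdaptCLT

section
variable {E X : Type*} [NormedAddCommGroup E] [MeasurableSpace E] [MeasurableSpace X]
    {P : E → X → Measure X} {π : Measure X} {C ρ : ℝ}

theorem Setup.P_lip (h : Setup P π C ρ) {Sset : Set E} {L : ℝ}
    (hA7 : ∀ s ∈ Sset, ∀ s' ∈ Sset, ∀ x, tvDist (P s x) (P s' x) ≤ L * ‖s - s'‖)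
    {f : X → ℝ} {B : ℝ} (hf : BM f B) {s s' : E} (hs : s ∈ Sset) (hs' : s' ∈ Sset) (x : X) :
    |∫ y, f y ∂(P s x) - ∫ y, f y ∂(P s' x)| ≤ 2 * B * (L * ‖s - s'‖) := by
  have := h.prob s x
  have := h.prob s' x
  have hB : 0 ≤ B := (abs_nonneg _).trans (hf.bound x)
  refine (tv_integral _ _ hf).trans ?_
  have := hA7 s hs s' hs' x
  gcongr

theorem Setup.g_lip (h : Setup P π C ρ) {Sset : Set E} {L : ℝ}
    (hA7 : ∀ s ∈ Sset, ∀ s' ∈ Sset, ∀ x, tvDist (P s x) (P s' x) ≤ L * ‖s - s'‖)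
    {φ : X → ℝ} {B : ℝ} (hφ : BM φ B) :
    ∃ K, ∀ s ∈ Sset, ∀ s' ∈ Sset, ∀ x,
      |gfun P π φ s x - gfun P π φ s' x| ≤ K * ‖s - s'‖ := by
  refine ⟨2 * (2 * (2 * (2 * B) * C / (1 - ρ)) * L) * C / (1 - ρ), fun s hs s' hs' x => ?_⟩
  have := h.hπ
  set G := 2 * (2 * B) * C / (1 - ρ) with hG
  have hg := h.g_BM hφ s
  have hg' := h.g_BM hφ s'
  rw [← hG] at hg hg'
  have hw : BM (fun x => gfun P π φ s x - gfun P π φ s' x) (2 * G) :=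
    ⟨hg.meas.sub hg'.meas, fun x => (abs_sub _ _).trans (by
      linarith [hg.bound x, hg'.bound x])⟩
  have hr : BM (fun x => ∫ y, gfun P π φ s' y ∂(P s x) - ∫ y, gfun P π φ s' y ∂(P s' x))
      (2 * G * (L * ‖s - s'‖)) :=
    ⟨(h.P_BM s hg').meas.sub (h.P_BM s' hg').meas, fun x => h.P_lip hA7 hg' hs hs' x⟩
  have := h.resolvent s hw hr (fun x => ?_) ?_ x
  · refine this.trans (le_of_eq ?_)
    ring
  · have := h.prob s x
    have e1 := h.poisson hφ s x
    have e2 := h.poisson hφ s' x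
    unfold Pg at e1 e2
    rw [integral_sub (hg.integrable _) (hg'.integrable _)]
    linarith
  · rw [integral_sub (hg.integrable _) (hg'.integrable _), h.g_mean hφ, h.g_mean hφ, sub_self]

/-- The conditional variance of the martingale increment. -/
noncomputable def vv (P : E → X → Measure X) (π : Measure X) (φ : X → ℝ) (p : E × X) : ℝ :=
  ∫ y, gfun P π φ p.1 y ^ 2 ∂(P p.1 p.2) - Pg P π φ p.1 p.2 ^ 2

theorem BM.sq {f : X → ℝ} {B : ℝ} (h : BM f B) : BM (fun x => f x ^ 2) (B ^ 2) :=
  ⟨h.meas.pow_const 2, fun x => by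
    rw [abs_pow]; exact pow_le_pow_left₀ (abs_nonneg _) (h.bound x) 2⟩

theorem Setup.vv_eq (h : Setup P π C ρ) {φ : X → ℝ} {B : ℝ} (hφ : BM φ B) (p : E × X) :
    vv P π φ p = ∫ y, (gfun P π φ p.1 y - Pg P π φ p.1 p.2) ^ 2 ∂(P p.1 p.2) := by
  have := h.prob p.1 p.2
  have hg := h.g_BM hφ p.1
  have e : ∀ y, (gfun P π φ p.1 y - Pg P π φ p.1 p.2) ^ 2 =
    gfun P π φ p.1 y ^ 2 - (2 * Pg P π φ p.1 p.2) * gfun P π φ p.1 y + Pg P π φ p.1 p.2 ^ 2 :=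
    fun y => by ring
  have i1 : Integrable (fun y => gfun P π φ p.1 y ^ 2 -
      (2 * Pg P π φ p.1 p.2) * gfun P π φ p.1 y) (P p.1 p.2) :=
    (hg.sq.integrable _).sub ((hg.integrable _).const_mul _)
  simp_rw [e]
  rw [integral_add i1 (integrable_const _), integral_sub (hg.sq.integrable _) ((hg.integrable _).const_mul _),
    integral_const_mul]
  simp only [integral_const, probReal_univ, smul_eq_mul, one_mul]
  have : ∫ y, gfun P π φ p.1 y ∂(P p.1 p.2) = Pg P π φ p.1 p.2 := rfl
  rw [this, vv]; ring

theorem Setup.Pg_measJ (h : Setup P π C ρ) {φ : X → ℝ} {B : ℝ} (hφ : BM φ B) :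
    Measurable fun p : E × X => Pg P π φ p.1 p.2 :=
  h.P_measJ (h.g_measJ hφ)

theorem Setup.vv_measJ (h : Setup P π C ρ) {φ : X → ℝ} {B : ℝ} (hφ : BM φ B) :
    Measurable (vv P π φ) :=
  (h.P_measJ ((h.g_measJ hφ).pow_const 2)).sub ((h.Pg_measJ hφ).pow_const 2)

theorem Setup.vv_nonneg (h : Setup P π C ρ) {φ : X → ℝ} {B : ℝ} (hφ : BM φ B) (p : E × X) :
    0 ≤ vv P π φ p := by
  rw [h.vv_eq hφ]
  exact integral_nonneg fun y => sq_nonneg _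

theorem Setup.vv_le (h : Setup P π C ρ) {φ : X → ℝ} {B : ℝ} (hφ : BM φ B) (p : E × X) :
    vv P π φ p ≤ (2 * (2 * B) * C / (1 - ρ)) ^ 2 := by
  have := h.prob p.1 p.2
  have := (abs_le.1 ((h.g_BM hφ p.1).sq.abs_integral_le (P p.1 p.2))).2
  unfold vv
  nlinarith [sq_nonneg (Pg P π φ p.1 p.2)]

theorem Setup.vv_mean (h : Setup P π C ρ) {φ : X → ℝ} {B : ℝ} (hφ : BM φ B) (s : E) :
    ∫ x, vv P π φ (s, x) ∂π = ∫ x, (gfun P π φ s x ^ 2 - Pg P π φ s x ^ 2) ∂π := by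
  have := h.hπ
  have hg := h.g_BM hφ s
  have hp : BM (Pg P π φ s) _ := h.P_BM s hg
  unfold vv
  simp only
  rw [integral_sub ((h.P_BM s hg.sq).integrable _) (hp.sq.integrable _),
    integral_sub (hg.sq.integrable _) (hp.sq.integrable _), h.inv_integral s hg.sq]

theorem Setup.vv_lip (h : Setup P π C ρ) {Sset : Set E} {L : ℝ}
    (hA7 : ∀ s ∈ Sset, ∀ s' ∈ Sset, ∀ x, tvDist (P s x) (P s' x) ≤ L * ‖s - s'‖)
    {φ : X → ℝ} {B : ℝ} (hφ : BM φ B) :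
    ∃ K, ∀ s ∈ Sset, ∀ s' ∈ Sset, ∀ x,
      |vv P π φ (s, x) - vv P π φ (s', x)| ≤ K * ‖s - s'‖ := by
  obtain ⟨K, hK⟩ := h.g_lip hA7 hφ
  set G := 2 * (2 * B) * C / (1 - ρ) with hGdef
  refine ⟨2 * G * K + 2 * G ^ 2 * L + 2 * G * K, fun s hs s' hs' x => ?_⟩
  have := h.prob s x
  have hg := h.g_BM hφ s
  have hg' := h.g_BM hφ s'
  rw [← hGdef] at hg hg'
  have hG : 0 ≤ G := (abs_nonneg _).trans (hg.bound x)
  have sqd : ∀ a b : ℝ, |a| ≤ G → |b| ≤ G → |a - b| ≤ K * ‖s - s'‖ →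
      |a ^ 2 - b ^ 2| ≤ 2 * G * K * ‖s - s'‖ := by
    intro a b ha hb hab
    have : a ^ 2 - b ^ 2 = (a + b) * (a - b) := by ring
    rw [this, abs_mul]
    calc |a + b| * |a - b| ≤ (2 * G) * (K * ‖s - s'‖) := by
          refine mul_le_mul ((abs_add_le _ _).trans (by linarith)) hab (abs_nonneg _) (by linarith)
      _ = _ := by ring
  have h1 : |∫ y, gfun P π φ s y ^ 2 ∂(P s x) - ∫ y, gfun P π φ s' y ^ 2 ∂(P s x)|
      ≤ 2 * G * K * ‖s - s'‖ := by
    rw [← integral_sub (hg.sq.integrable _) (hg'.sq.integrable _)]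
    refine BM.abs_integral_le ⟨hg.sq.meas.sub hg'.sq.meas, fun y => ?_⟩ _
    exact sqd _ _ (hg.bound y) (hg'.bound y) (hK s hs s' hs' y)
  have h2 := h.P_lip hA7 hg'.sq hs hs' x
  have h3 : |Pg P π φ s x ^ 2 - Pg P π φ s' x ^ 2| ≤ 2 * G * K * ‖s - s'‖ := by
    refine sqd _ _ ((h.P_BM s hg).bound x) ((h.P_BM s' hg').bound x) ?_
    have e1 := h.poisson hφ s x
    have e2 := h.poisson hφ s' x
    rw [show Pg P π φ s x - Pg P π φ s' x = gfun P π φ s x - gfun P π φ s' x by linarith]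
    exact hK s hs s' hs' x
  unfold vv
  simp only
  rw [abs_le] at *
  constructor <;> nlinarith [h1.1, h1.2, h2.1, h2.2, h3.1, h3.2]

/-- The adaptive process. -/
structure Proc {Ω : Type*} [mΩ : MeasurableSpace Ω] (P : E → X → Measure X) (μ : Measure Ω)
    (F : Filtration ℕ mΩ) (Sp : ℕ → Ω → E) (Xp : ℕ → Ω → X) : Prop where
  adapted : ∀ k, Measurable[F k] fun ω => (Sp k ω, Xp k ω)
  markov : ∀ (k : ℕ) (A : Set X), MeasurableSet A →
      μ[fun ω => A.indicator (fun _ => (1 : ℝ)) (Xp (k + 1) ω) | F k]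
        =ᵐ[μ] fun ω => (P (Sp k ω) (Xp k ω) A).toReal

variable {Ω : Type*} [mΩ : MeasurableSpace Ω] {μ : Measure Ω} [IsProbabilityMeasure μ]
  {F : Filtration ℕ mΩ} {Sp : ℕ → Ω → E} {Xp : ℕ → Ω → X}

theorem Proc.measX (p : Proc P μ F Sp Xp) (k : ℕ) : Measurable[F k] (Xp k) :=
  measurable_snd.comp (p.adapted k)

theorem Proc.key (h : Setup P π C ρ) (p : Proc P μ F Sp Xp) (k : ℕ) {T : Type*}
    [MeasurableSpace T] {U : Ω → T} (hU : Measurable[F k] U) :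
    μ.map (fun ω => ((U ω, (Sp k ω, Xp k ω)), Xp (k+1) ω)) =
      (μ.map (fun ω => (U ω, (Sp k ω, Xp k ω)))) ⊗ₘ
        (Kernel.prodMkLeft T (⟨_, h.measJ⟩ : Kernel (E × X) X)) := by
  let K : Kernel (E × X) X := ⟨_, h.measJ⟩
  have : IsMarkovKernel K := ⟨fun q => h.prob q.1 q.2⟩
  have m1 : Measurable[F k] fun ω => (U ω, (Sp k ω, Xp k ω)) := hU.prodMk (p.adapted k)
  have m1' := m1.mono (F.le k) le_rfl
  have m2 := (p.measX (k+1)).mono (F.le _) le_rfl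
  have := Measure.isProbabilityMeasure_map (μ := μ) (m1'.prodMk m2).aemeasurable
  have := Measure.isProbabilityMeasure_map (μ := μ) m1'.aemeasurable
  refine Measure.ext_prod fun {s t} hs ht => ?_
  rw [Measure.map_apply (m1'.prodMk m2) (hs.prod ht)]
  change _ = ((μ.map (fun ω => (U ω, (Sp k ω, Xp k ω)))) ⊗ₘ (Kernel.prodMkLeft T K)) (s ×ˢ t)
  rw [Measure.compProd_apply_prod hs ht,
    setLIntegral_map hs (Kernel.measurable_coe _ ht) m1']
  set A := (fun ω => (U ω, (Sp k ω, Xp k ω))) ⁻¹' s with hA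
  have hAm : MeasurableSet[F k] A := m1 hs
  have hAm' := F.le k _ hAm
  have e1 : (fun ω => ((U ω, (Sp k ω, Xp k ω)), Xp (k+1) ω)) ⁻¹' s ×ˢ t
      = (Xp (k+1)) ⁻¹' t ∩ A := by
    ext ω; simp [hA, and_comm]
  rw [e1]
  have hi : Integrable (fun ω => t.indicator (fun _ => (1 : ℝ)) (Xp (k + 1) ω)) μ := by
    refine Integrable.of_bound ((measurable_const.indicator ht).comp m2).aestronglyMeasurable 1
      (ae_of_all _ fun ω => ?_)
    by_cases hh : Xp (k+1) ω ∈ t <;> simp [hh]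
  have e2 := setIntegral_condExp (F.le k) hi hAm
  rw [setIntegral_congr_ae (g := fun ω => (P (Sp k ω) (Xp k ω) t).toReal) hAm'
    ((p.markov k t ht).mono fun _ hh _ => hh)] at e2
  have e3 : ∫ ω in A, t.indicator (fun _ => (1 : ℝ)) (Xp (k + 1) ω) ∂μ
      = (μ ((Xp (k+1)) ⁻¹' t ∩ A)).toReal := by
    have : (fun ω => t.indicator (fun _ => (1 : ℝ)) (Xp (k + 1) ω))
        = ((Xp (k+1)) ⁻¹' t).indicator 1 := by
      ext ω; by_cases hh : Xp (k+1) ω ∈ t <;> simp [hh]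
    rw [this, integral_indicator_one (m2 ht), measureReal_restrict_apply (m2 ht)]; rfl
  rw [e3] at e2
  have mP : Measurable fun ω => P (Sp k ω) (Xp k ω) t :=
    (h.meas t ht).comp ((p.adapted k).mono (F.le k) le_rfl)
  rw [integral_toReal mP.aemeasurable
    (ae_of_all _ fun ω => by have := h.prob (Sp k ω) (Xp k ω); exact measure_lt_top _ _)] at e2
  have hfin : ∫⁻ ω in A, P (Sp k ω) (Xp k ω) t ∂μ ≠ ∞ := by
    refine ((lintegral_mono (g := fun _ => 1) fun ω => ?_).trans_lt ?_).ne
    · have := h.prob (Sp k ω) (Xp k ω); exact prob_le_one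
    · simp
  have := (ENNReal.toReal_eq_toReal_iff' hfin (measure_ne_top _ _)).1 e2
  rw [← this]; rfl

theorem Proc.integral {𝕜 : Type*} [RCLike 𝕜] (h : Setup P π C ρ)
    (p : Proc P μ F Sp Xp) (k : ℕ) {U : Ω → 𝕜} (hU : Measurable[F k] U) {BU BG : ℝ}
    (hUb : ∀ ω, ‖U ω‖ ≤ BU) {G : E × X → X → 𝕜} (hG : Measurable (Function.uncurry G))
    (hGb : ∀ q y, ‖G q y‖ ≤ BG) :
    ∫ ω, U ω * G (Sp k ω, Xp k ω) (Xp (k+1) ω) ∂μ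
      = ∫ ω, U ω * ∫ y, G (Sp k ω, Xp k ω) y ∂(P (Sp k ω) (Xp k ω)) ∂μ := by
  have : IsMarkovKernel (⟨_, h.measJ⟩ : Kernel (E × X) X) := ⟨fun q => h.prob q.1 q.2⟩
  have key := Proc.key h p k hU
  have m1 : Measurable[F k] fun ω => (U ω, (Sp k ω, Xp k ω)) := hU.prodMk (p.adapted k)
  have m1' := m1.mono (F.le k) le_rfl
  have m2 := (p.measX (k+1)).mono (F.le _) le_rfl
  have := Measure.isProbabilityMeasure_map (μ := μ) m1'.aemeasurable
  let J : (𝕜 × (E × X)) × X → 𝕜 := fun z => z.1.1 * G z.1.2 z.2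
  have hJ : Measurable J := (measurable_fst.comp measurable_fst).mul
    (hG.comp ((measurable_snd.comp measurable_fst).prodMk measurable_snd))
  have l1 : ∫ ω, U ω * G (Sp k ω, Xp k ω) (Xp (k+1) ω) ∂μ
      = ∫ z, J z ∂(μ.map (fun ω => ((U ω, (Sp k ω, Xp k ω)), Xp (k+1) ω))) := by
    rw [integral_map (m1'.prodMk m2).aemeasurable hJ.aestronglyMeasurable]
  have hJint : Integrable J (μ.map (fun ω => ((U ω, (Sp k ω, Xp k ω)), Xp (k+1) ω))) := by
    rw [integrable_map_measure hJ.aestronglyMeasurable (m1'.prodMk m2).aemeasurable]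
    refine Integrable.of_bound (hJ.comp (m1'.prodMk m2)).aestronglyMeasurable (BU * BG)
      (ae_of_all _ fun ω => ?_)
    simp only [Function.comp, J, norm_mul]
    exact mul_le_mul (hUb ω) (hGb _ _) (norm_nonneg _) ((norm_nonneg _).trans (hUb ω))
  rw [key] at hJint l1
  rw [l1, Measure.integral_compProd hJint, integral_map m1'.aemeasurable]
  · refine integral_congr_ae (ae_of_all _ fun ω => ?_)
    simp only [J, Kernel.prodMkLeft_apply]
    exact integral_const_mul _ _
  · exact (StronglyMeasurable.integral_kernel_prod_right'
      (κ := Kernel.prodMkLeft 𝕜 (⟨_, h.measJ⟩ : Kernel (E × X) X))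
      hJ.stronglyMeasurable).aestronglyMeasurable

end

end AdaptCLT

namespace AdaptCLT

theorem taylor_step {X : Type*} [MeasurableSpace X] (m : Measure X) [IsProbabilityMeasure m]
    {d : X → ℝ} {D : ℝ} (hd : BM d D) (h0 : ∫ y, d y ∂m = 0) {a T : ℝ} (ha : |a| ≤ T) :
    ‖(∫ y, Complex.exp (Complex.I * a * d y) ∂m) *
        Complex.exp (((a ^ 2 / 2 * ∫ y, d y ^ 2 ∂m : ℝ) : ℂ)) - 1‖
      ≤ ((D ^ 3 * Real.exp (T * D) + T * D ^ 4 * Real.exp (T ^ 2 * D ^ 2)) *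
          Real.exp (T ^ 2 * D ^ 2)) * |a| ^ 3 := by
  have hne : Nonempty X := by
    by_contra hX
    rw [not_nonempty_iff] at hX
    have : m Set.univ = 1 := measure_univ
    rw [Set.univ_eq_empty_iff.2 hX] at this
    simp at this
  have hD : 0 ≤ D := (abs_nonneg _).trans (hd.bound hne.some)
  have hT : 0 ≤ T := (abs_nonneg _).trans ha
  set v := ∫ y, d y ^ 2 ∂m with hv
  set u := a ^ 2 / 2 * v with hu
  have hv0 : 0 ≤ v := integral_nonneg fun _ => sq_nonneg _
  have hv1 : v ≤ D ^ 2 := (abs_le.1 (hd.sq.abs_integral_le m)).2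
  have hu0 : 0 ≤ u := by positivity
  have haT : a ^ 2 ≤ T ^ 2 := by rw [← sq_abs a]; exact pow_le_pow_left₀ (abs_nonneg _) ha 2
  have hu1 : u ≤ a ^ 2 * D ^ 2 := by
    have : a ^ 2 / 2 * v ≤ a ^ 2 / 2 * D ^ 2 := by gcongr
    nlinarith [mul_nonneg (sq_nonneg a) (sq_nonneg D)]
  have hu2 : u ≤ T ^ 2 * D ^ 2 := hu1.trans (by gcongr)
  -- main expansion
  have i0 : Integrable (fun y => Complex.exp (Complex.I * a * d y)) m := by
    refine Integrable.of_bound ?_ 1 (ae_of_all _ fun y => ?_)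
    · have := hd.meas
      exact (by fun_prop : Measurable fun y => Complex.exp (Complex.I * a * d y)).aestronglyMeasurable
    · rw [Complex.norm_exp]; simp
  have i1 : Integrable (fun y => (d y : ℂ)) m := (hd.integrable m).ofReal
  have i2 : Integrable (fun y => ((d y ^ 2 : ℝ) : ℂ)) m := (hd.sq.integrable m).ofReal
  have e1 : ∫ y, ((1 : ℂ) + Complex.I * a * d y - ((a ^ 2 / 2 : ℝ) : ℂ) * ((d y ^ 2 : ℝ) : ℂ)) ∂m
      = 1 - (u : ℂ) := by
    have i3 : Integrable (fun y => (1 : ℂ) + Complex.I * a * d y) m :=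
      (integrable_const _).add (i1.const_mul _)
    rw [integral_sub i3 (i2.const_mul _), integral_add (integrable_const _) (i1.const_mul _),
      integral_const_mul, integral_const_mul, integral_complex_ofReal, integral_complex_ofReal, h0, ← hv]
    simp [hu]
  have b1 : ‖(∫ y, Complex.exp (Complex.I * a * d y) ∂m) - (1 - (u : ℂ))‖
      ≤ |a| ^ 3 * (D ^ 3 * Real.exp (T * D)) := by
    have i3 : Integrable (fun y => (1 : ℂ) + Complex.I * a * d y -
        ((a ^ 2 / 2 : ℝ) : ℂ) * ((d y ^ 2 : ℝ) : ℂ)) m :=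
      ((integrable_const _).add (i1.const_mul _)).sub (i2.const_mul _)
    rw [← e1, ← integral_sub i0 i3]
    have := norm_integral_le_of_norm_le_const (μ := m)
      (f := fun y => Complex.exp (Complex.I * a * d y) - ((1 : ℂ) + Complex.I * a * d y -
        ((a ^ 2 / 2 : ℝ) : ℂ) * ((d y ^ 2 : ℝ) : ℂ)))
      (C := |a| ^ 3 * (D ^ 3 * Real.exp (T * D))) (ae_of_all _ fun y => ?_)
    · simpa using this
    · have hb := Complex.norm_exp_sub_sum_le_norm_mul_exp (Complex.I * a * d y) 3
      have hz : ‖Complex.I * a * d y‖ = |a| * |d y| := by simp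
      have hs : ∑ i ∈ Finset.range 3, (Complex.I * a * d y) ^ i / (i.factorial : ℂ)
          = (1 : ℂ) + Complex.I * a * d y - ((a ^ 2 / 2 : ℝ) : ℂ) * ((d y ^ 2 : ℝ) : ℂ) := by
        simp only [Finset.sum_range_succ, Finset.range_zero, Finset.sum_empty, Nat.factorial]
        push_cast
        have : Complex.I ^ 2 = -1 := Complex.I_sq
        simp only [mul_pow, this]
        ring
      rw [hz, hs] at hb
      refine hb.trans ?_
      rw [mul_pow, mul_assoc]
      have := hd.bound y
      gcongr
  have b2 : ‖(1 - (u : ℂ)) - Complex.exp (-(u : ℂ))‖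
      ≤ |a| ^ 3 * (T * D ^ 4 * Real.exp (T ^ 2 * D ^ 2)) := by
    have hb := Complex.norm_exp_sub_sum_le_norm_mul_exp (-(u : ℂ)) 2
    have hs : ∑ i ∈ Finset.range 2, (-(u : ℂ)) ^ i / (i.factorial : ℂ) = 1 - (u : ℂ) := by
      simp [Finset.sum_range_succ, Nat.factorial]; ring
    rw [hs, norm_sub_rev, norm_neg, Complex.norm_real, Real.norm_of_nonneg hu0] at hb
    refine hb.trans ?_
    have h2 : u ^ 2 ≤ |a| ^ 3 * (T * D ^ 4) := by
      calc u ^ 2 ≤ (a ^ 2 * D ^ 2) ^ 2 := by gcongr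
        _ = |a| ^ 3 * |a| * D ^ 4 := by rw [← sq_abs a]; ring
        _ ≤ |a| ^ 3 * T * D ^ 4 := by gcongr
        _ = _ := by ring
    calc u ^ 2 * Real.exp u ≤ (|a| ^ 3 * (T * D ^ 4)) * Real.exp (T ^ 2 * D ^ 2) := by gcongr
      _ = _ := by ring
  have e2 : (∫ y, Complex.exp (Complex.I * a * d y) ∂m) * Complex.exp ((u : ℝ) : ℂ) - 1
      = (((∫ y, Complex.exp (Complex.I * a * d y) ∂m) - (1 - (u : ℂ))) +
        ((1 - (u : ℂ)) - Complex.exp (-(u : ℂ)))) * Complex.exp ((u : ℝ) : ℂ) := by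
    have : Complex.exp (-(u : ℂ)) * Complex.exp ((u : ℝ) : ℂ) = 1 := by
      rw [← Complex.exp_add]; simp
    linear_combination this
  rw [e2, norm_mul]
  have b3 : ‖Complex.exp ((u : ℝ) : ℂ)‖ ≤ Real.exp (T ^ 2 * D ^ 2) := by
    rw [Complex.norm_exp, Complex.ofReal_re]; gcongr
  calc _ ≤ (|a| ^ 3 * (D ^ 3 * Real.exp (T * D)) +
        |a| ^ 3 * (T * D ^ 4 * Real.exp (T ^ 2 * D ^ 2))) * Real.exp (T ^ 2 * D ^ 2) :=
        mul_le_mul ((norm_add_le _ _).trans (add_le_add b1 b2)) b3 (norm_nonneg _) (by positivity)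
    _ = _ := by ring

section
variable {E X : Type*} [NormedAddCommGroup E] [MeasurableSpace E] [MeasurableSpace X]
    {P : E → X → Measure X} {π : Measure X} {C ρ : ℝ}
variable {Ω : Type*} [mΩ : MeasurableSpace Ω] {μ : Measure Ω} [IsProbabilityMeasure μ]
  {F : Filtration ℕ mΩ} {Sp : ℕ → Ω → E} {Xp : ℕ → Ω → X}

/-- The martingale with increments `d (S_k, X_k) X_{k+1}`. -/
noncomputable def MM (Sp : ℕ → Ω → E) (Xp : ℕ → Ω → X) (d : E × X → X → ℝ) (n : ℕ) (ω : Ω) : ℝ :=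
  ∑ k ∈ Finset.range n, d (Sp k ω, Xp k ω) (Xp (k + 1) ω)

/-- Additive functional of `(S_k, X_k)`. -/
noncomputable def VV (Sp : ℕ → Ω → E) (Xp : ℕ → Ω → X) (v : E × X → ℝ) (n : ℕ) (ω : Ω) : ℝ :=
  ∑ k ∈ Finset.range n, v (Sp k ω, Xp k ω)

/-- Martingale-difference function. -/
structure MD (P : E → X → Measure X) (d : E × X → X → ℝ) (D : ℝ) : Prop where
  meas : Measurable (Function.uncurry d)
  bound : ∀ q y, |d q y| ≤ D
  mean : ∀ q, ∫ y, d q y ∂(P q.1 q.2) = 0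

theorem MD.BM {d : E × X → X → ℝ} {D : ℝ} (hd : MD P d D) (q : E × X) : BM (d q) D :=
  ⟨hd.meas.comp measurable_prodMk_left, hd.bound q⟩

theorem Proc.MM_meas (p : Proc P μ F Sp Xp) {d : E × X → X → ℝ}
    (hd : Measurable (Function.uncurry d)) (n : ℕ) : Measurable[F n] (MM Sp Xp d n) := by
  refine Finset.measurable_sum _ fun k hk => ?_
  have hk := Finset.mem_range.1 hk
  exact hd.comp (((p.adapted k).mono (F.mono hk.le) le_rfl).prodMk
    ((p.measX (k+1)).mono (F.mono hk) le_rfl))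

theorem Proc.VV_meas (p : Proc P μ F Sp Xp) {v : E × X → ℝ} (hv : Measurable v) (n : ℕ) :
    Measurable[F n] (VV Sp Xp v n) := by
  refine Finset.measurable_sum _ fun k hk => ?_
  have hk := Finset.mem_range.1 hk
  exact hv.comp ((p.adapted k).mono (F.mono hk.le) le_rfl)

theorem MM_bound {d : E × X → X → ℝ} {D : ℝ} (hd : ∀ q y, |d q y| ≤ D) (n : ℕ) (ω : Ω) :
    |MM Sp Xp d n ω| ≤ n * D := by
  refine (Finset.abs_sum_le_sum_abs _ _).trans ?_
  refine (Finset.sum_le_sum fun k _ => hd _ _).trans ?_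
  simp

theorem VV_bound {v : E × X → ℝ} {D : ℝ} (hv : ∀ q, |v q| ≤ D) (n : ℕ) (ω : Ω) :
    |VV Sp Xp v n ω| ≤ n * D := by
  refine (Finset.abs_sum_le_sum_abs _ _).trans ?_
  refine (Finset.sum_le_sum fun k _ => hv _).trans ?_
  simp

theorem Proc.MM_sq (h : Setup P π C ρ) (p : Proc P μ F Sp Xp) {d : E × X → X → ℝ} {D : ℝ}
    (hd : MD P d D) (n : ℕ) : ∫ ω, MM Sp Xp d n ω ^ 2 ∂μ ≤ n * D ^ 2 := by
  induction n with
  | zero => simp [MM]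
  | succ n ih =>
    have mM := (p.MM_meas hd.meas n)
    have bM : BM (MM Sp Xp d n) (n * D) := ⟨mM.mono (F.le n) le_rfl, MM_bound hd.bound n⟩
    have bd : BM (fun ω => d (Sp n ω, Xp n ω) (Xp (n+1) ω)) D :=
      ⟨hd.meas.comp (((p.adapted n).mono (F.le n) le_rfl).prodMk
        ((p.measX (n+1)).mono (F.le _) le_rfl)), fun ω => hd.bound _ _⟩
    have e : ∀ ω, MM Sp Xp d (n+1) ω ^ 2 = MM Sp Xp d n ω ^ 2 +
        2 * (MM Sp Xp d n ω * d (Sp n ω, Xp n ω) (Xp (n+1) ω)) +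
        d (Sp n ω, Xp n ω) (Xp (n+1) ω) ^ 2 := by
      intro ω
      simp only [MM, Finset.sum_range_succ]; ring
    have bMd : BM (fun ω => MM Sp Xp d n ω * d (Sp n ω, Xp n ω) (Xp (n+1) ω)) (n * D * D) :=
      ⟨bM.meas.mul bd.meas, fun ω => by
        rw [abs_mul]
        exact mul_le_mul (bM.bound ω) (bd.bound ω) (abs_nonneg _)
          ((abs_nonneg _).trans (bM.bound ω))⟩
    have z : ∫ ω, MM Sp Xp d n ω * d (Sp n ω, Xp n ω) (Xp (n+1) ω) ∂μ = 0 := by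
      rw [Proc.integral (𝕜 := ℝ) h p n mM (MM_bound hd.bound n) hd.meas hd.bound]
      simp_rw [fun ω => hd.mean (Sp n ω, Xp n ω)]
      simp
    have i1 : Integrable (fun ω => MM Sp Xp d n ω ^ 2 +
        2 * (MM Sp Xp d n ω * d (Sp n ω, Xp n ω) (Xp (n+1) ω))) μ :=
      (bM.sq.integrable _).add ((bMd.integrable _).const_mul 2)
    simp_rw [e]
    rw [integral_add i1 (bd.sq.integrable _),
      integral_add (bM.sq.integrable _) ((bMd.integrable _).const_mul 2), integral_const_mul, z]
    have := (abs_le.1 (bd.sq.abs_integral_le μ)).2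
    push_cast
    linarith

theorem Proc.MM_l1 (h : Setup P π C ρ) (p : Proc P μ F Sp Xp) {d : E × X → X → ℝ} {D : ℝ}
    (hd : MD P d D) :
    Tendsto (fun n : ℕ => (∫ ω, |MM Sp Xp d n ω| ∂μ) / n) atTop (𝓝 0) := by
  have hlim : Tendsto (fun n : ℕ => (D ^ 2 + 1) / 2 * (Real.sqrt n)⁻¹) atTop (𝓝 0) := by
    have := (tendsto_inv_atTop_zero.comp (Real.tendsto_sqrt_atTop.comp
      tendsto_natCast_atTop_atTop)).const_mul ((D ^ 2 + 1) / 2) (M := ℝ) (α := ℕ)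
    simpa using this
  refine squeeze_zero' (Eventually.of_forall fun n => ?_) ?_ hlim
  · have : 0 ≤ ∫ ω, |MM Sp Xp d n ω| ∂μ := integral_nonneg fun _ => abs_nonneg _
    positivity
  filter_upwards [eventually_gt_atTop 0] with n hn
  have hn' : (0 : ℝ) < n := by exact_mod_cast hn
  have hs : 0 < Real.sqrt n := Real.sqrt_pos.2 hn'
  have hss : Real.sqrt n * Real.sqrt n = n := Real.mul_self_sqrt hn'.le
  have bM : BM (MM Sp Xp d n) (n * D) :=
    ⟨(p.MM_meas hd.meas n).mono (F.le n) le_rfl, MM_bound hd.bound n⟩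
  have key : ∫ ω, |MM Sp Xp d n ω| ∂μ ≤
      ∫ ω, (1 / (2 * Real.sqrt n) * MM Sp Xp d n ω ^ 2 + Real.sqrt n / 2) ∂μ := by
    refine integral_mono (bM.integrable μ).abs
      (((bM.sq.integrable μ).const_mul _).add (integrable_const _)) fun ω => ?_
    simp only
    rw [← sq_abs]
    have h1 := sq_nonneg (|MM Sp Xp d n ω| - Real.sqrt n)
    have : 1 / (2 * Real.sqrt n) * |MM Sp Xp d n ω| ^ 2 + Real.sqrt n / 2
        = |MM Sp Xp d n ω| + (|MM Sp Xp d n ω| - Real.sqrt n) ^ 2 / (2 * Real.sqrt n) := by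
      field_simp; ring
    rw [this]
    have : 0 ≤ (|MM Sp Xp d n ω| - Real.sqrt n) ^ 2 / (2 * Real.sqrt n) := by positivity
    linarith
  rw [integral_add ((bM.sq.integrable μ).const_mul _) (integrable_const _),
    integral_const_mul] at key
  simp only [integral_const, probReal_univ, smul_eq_mul, one_mul] at key
  have h2 := Proc.MM_sq h p hd n
  rw [div_le_iff₀ hn']
  refine key.trans ?_
  have : 1 / (2 * Real.sqrt n) * ∫ ω, MM Sp Xp d n ω ^ 2 ∂μ ≤ 1 / (2 * Real.sqrt n) * (n * D ^ 2) := by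
    gcongr
  refine (add_le_add_left this _).trans (le_of_eq ?_)
  have hn2 : (n : ℝ) = Real.sqrt n ^ 2 := (Real.sq_sqrt hn'.le).symm
  clear key this hss hlim bM h2
  generalize Real.sqrt n = r at *
  rw [hn2]; field_simp

theorem Proc.clt_char (h : Setup P π C ρ) (p : Proc P μ F Sp Xp) {d : E × X → X → ℝ} {D : ℝ}
    (hd : MD P d D) {v : E × X → ℝ} (hvm : Measurable v)
    (hv : ∀ q, v q = ∫ y, d q y ^ 2 ∂(P q.1 q.2)) {σ2 : ℝ}
    (hV : Tendsto (fun n : ℕ => ∫ ω, |VV Sp Xp v n ω / n - σ2| ∂μ) atTop (𝓝 0)) (t : ℝ) :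
    Tendsto (fun n : ℕ => ∫ ω, Complex.exp (Complex.I * (t / Real.sqrt n : ℝ) *
      (MM Sp Xp d n ω : ℝ)) ∂μ) atTop (𝓝 (Complex.exp ((-(t ^ 2 / 2 * σ2) : ℝ) : ℂ))) := by
  have hv0 : ∀ q, 0 ≤ v q := fun q => by rw [hv]; exact integral_nonneg fun _ => sq_nonneg _
  have hv1 : ∀ q, v q ≤ D ^ 2 := fun q => by
    have := h.prob q.1 q.2
    rw [hv]; exact (abs_le.1 ((hd.BM q).sq.abs_integral_le _)).2
  have hv2 : ∀ q, |v q| ≤ D ^ 2 := fun q => by rw [abs_of_nonneg (hv0 q)]; exact hv1 q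
  have hVV0 : ∀ n ω, 0 ≤ VV Sp Xp v n ω := fun n ω => Finset.sum_nonneg fun k _ => hv0 _
  have hVV1 : ∀ n ω, VV Sp Xp v n ω ≤ n * D ^ 2 := fun n ω => (abs_le.1 (VV_bound hv2 n ω)).2
  set K := ((D ^ 3 * Real.exp (|t| * D) + |t| * D ^ 4 * Real.exp (|t| ^ 2 * D ^ 2)) *
          Real.exp (|t| ^ 2 * D ^ 2)) with hK
  let R := Real.exp (t ^ 2 * D ^ 2)
  let Z : ℝ → ℕ → Ω → ℂ := fun a j ω =>
    Complex.exp (Complex.I * a * (MM Sp Xp d j ω : ℝ) + ((a ^ 2 / 2 * VV Sp Xp v j ω : ℝ) : ℂ))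
  have Zm : ∀ a j, Measurable[F j] (Z a j) := by
    intro a j
    have h1 := p.MM_meas hd.meas j
    have h2 := p.VV_meas hvm j
    exact Complex.measurable_exp.comp (((Complex.measurable_ofReal.comp h1).const_mul _).add
      (Complex.measurable_ofReal.comp (h2.const_mul _)))
  have Zn : ∀ a j ω, ‖Z a j ω‖ = Real.exp (a ^ 2 / 2 * VV Sp Xp v j ω) := by
    intro a j ω
    simp only [Z, Complex.norm_exp]
    congr 1
    rw [Complex.add_re, Complex.ofReal_re]; simp
  have step : ∀ a j, |a| ≤ |t| → (∀ ω, ‖Z a j ω‖ ≤ R) →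
      ‖∫ ω, Z a (j+1) ω ∂μ - ∫ ω, Z a j ω ∂μ‖ ≤ R * (K * |a| ^ 3) := by
    intro a j ha hZ
    let G : E × X → X → ℂ := fun q y => Complex.exp (Complex.I * a * (d q y : ℝ)) *
      Complex.exp ((a ^ 2 / 2 * v q : ℝ) : ℂ)
    have hG : Measurable (Function.uncurry G) := by
      have h1 := hd.meas
      have h2 : Measurable fun z : (E × X) × X => v z.1 := hvm.comp measurable_fst
      exact (Complex.measurable_exp.comp ((Complex.measurable_ofReal.comp h1).const_mul _)).mul
        (Complex.measurable_exp.comp (Complex.measurable_ofReal.comp (h2.const_mul _)))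
    have hGb : ∀ q y, ‖G q y‖ ≤ Real.exp (a ^ 2 / 2 * D ^ 2) := by
      intro q y
      simp only [G, norm_mul, Complex.norm_exp]
      have := hv1 q
      simp only [Complex.ofReal_re]
      have e : (Complex.I * a * (d q y : ℝ)).re = 0 := by simp
      rw [e, Real.exp_zero, one_mul]
      gcongr
    have e1 : ∀ ω, Z a (j+1) ω = Z a j ω * G (Sp j ω, Xp j ω) (Xp (j+1) ω) := by
      intro ω
      simp only [Z, G, MM, VV, Finset.sum_range_succ, ← Complex.exp_add]
      congr 1
      push_cast
      ring
    have e2 : ∫ ω, Z a (j+1) ω ∂μ = ∫ ω, Z a j ω *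
        ∫ y, G (Sp j ω, Xp j ω) y ∂(P (Sp j ω) (Xp j ω)) ∂μ := by
      simp_rw [e1]
      exact Proc.integral (𝕜 := ℂ) h p j (Zm a j) hZ hG hGb
    have gm : ∀ q : E × X, ‖(∫ y, G q y ∂(P q.1 q.2)) - 1‖ ≤ K * |a| ^ 3 := by
      intro q
      have := h.prob q.1 q.2
      have := taylor_step (P q.1 q.2) (hd.BM q) (hd.mean q) ha
      rw [← hv q] at this
      simp only [G]
      rw [integral_mul_const]
      exact this
    have Gmeas : Measurable fun ω => ∫ y, G (Sp j ω, Xp j ω) y ∂(P (Sp j ω) (Xp j ω)) := by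
      let Kr : Kernel (E × X) X := ⟨_, h.measJ⟩
      have : IsMarkovKernel Kr := ⟨fun q => h.prob q.1 q.2⟩
      exact (StronglyMeasurable.integral_kernel_prod_right (κ := Kr) (f := G)
        hG.stronglyMeasurable).measurable.comp ((p.adapted j).mono (F.le j) le_rfl)
    have Zm' := (Zm a j).mono (F.le j) le_rfl
    have iZ : Integrable (Z a j) μ := Integrable.of_bound Zm'.aestronglyMeasurable R
      (ae_of_all _ hZ)
    have bnd : ∀ ω, ‖Z a j ω * ((∫ y, G (Sp j ω, Xp j ω) y ∂(P (Sp j ω) (Xp j ω))) - 1)‖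
        ≤ R * (K * |a| ^ 3) := by
      intro ω
      rw [norm_mul]
      exact mul_le_mul (hZ ω) (gm (Sp j ω, Xp j ω)) (norm_nonneg _) (Real.exp_pos _).le
    have iD : Integrable (fun ω => Z a j ω *
        ((∫ y, G (Sp j ω, Xp j ω) y ∂(P (Sp j ω) (Xp j ω))) - 1)) μ :=
      Integrable.of_bound (Zm'.mul (Gmeas.sub_const 1)).aestronglyMeasurable _ (ae_of_all _ bnd)
    have e3 : ∫ ω, Z a (j+1) ω ∂μ - ∫ ω, Z a j ω ∂μ = ∫ ω, Z a j ω *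
        ((∫ y, G (Sp j ω, Xp j ω) y ∂(P (Sp j ω) (Xp j ω))) - 1) ∂μ := by
      rw [e2, sub_eq_iff_eq_add, ← integral_add iD iZ]
      congr 1; ext ω; ring
    rw [e3]
    have := norm_integral_le_of_norm_le_const (μ := μ) (ae_of_all _ bnd)
    simpa using this
  have ZR : ∀ n : ℕ, 0 < n → ∀ j ≤ n, ∀ ω, ‖Z (t / Real.sqrt n) j ω‖ ≤ R := by
    intro n hn j hj ω
    have hn' : (0 : ℝ) < n := by exact_mod_cast hn
    rw [Zn]
    apply Real.exp_le_exp.2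
    rw [div_pow, Real.sq_sqrt hn'.le]
    have h1 := hVV1 j ω
    have h0 := hVV0 j ω
    have hj' : (j : ℝ) ≤ n := by exact_mod_cast hj
    have h2 : VV Sp Xp v j ω ≤ n * D ^ 2 := h1.trans (by gcongr)
    calc t ^ 2 / n / 2 * VV Sp Xp v j ω ≤ t ^ 2 / n / 2 * (n * D ^ 2) := by gcongr
      _ = t ^ 2 * D ^ 2 / 2 := by field_simp
      _ ≤ t ^ 2 * D ^ 2 := by nlinarith [mul_nonneg (sq_nonneg t) (sq_nonneg D)]
  have absa : ∀ n : ℕ, 0 < n → |t / Real.sqrt n| ≤ |t| := by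
    intro n hn
    have : 1 ≤ Real.sqrt n := by rw [Real.one_le_sqrt]; exact_mod_cast hn
    rw [abs_div, abs_of_nonneg (Real.sqrt_nonneg _)]
    exact div_le_self (abs_nonneg _) this
  have A : ∀ n : ℕ, 0 < n → ‖∫ ω, Z (t / Real.sqrt n) n ω ∂μ - 1‖
      ≤ R * K * |t| ^ 3 * (Real.sqrt n)⁻¹ := by
    intro n hn
    have hn' : (0 : ℝ) < n := by exact_mod_cast hn
    have hs : 0 < Real.sqrt n := Real.sqrt_pos.2 hn'
    have hss : Real.sqrt n ^ 2 = n := Real.sq_sqrt hn'.le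
    set a := t / Real.sqrt n with hadef
    have : ∀ j ≤ n, ‖∫ ω, Z a j ω ∂μ - 1‖ ≤ j * (R * (K * |a| ^ 3)) := by
      intro j hj
      induction j with
      | zero => simp [Z, MM, VV]
      | succ j ih =>
        have h1 := ih (by omega)
        have h2 := step a j (absa n hn) (ZR n hn j (by omega))
        have : ∫ ω, Z a (j+1) ω ∂μ - 1 = (∫ ω, Z a (j+1) ω ∂μ - ∫ ω, Z a j ω ∂μ) +
          (∫ ω, Z a j ω ∂μ - 1) := by ring
        rw [this]
        refine (norm_add_le _ _).trans ?_
        push_cast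
        linarith
    refine (this n le_rfl).trans (le_of_eq ?_)
    rw [hadef, abs_div, abs_of_pos hs]
    have : (n : ℝ) = Real.sqrt n ^ 2 := hss.symm
    generalize Real.sqrt n = r at *
    rw [this]; field_simp
  have hsq : Tendsto (fun n : ℕ => (Real.sqrt n)⁻¹) atTop (𝓝 0) :=
    tendsto_inv_atTop_zero.comp (Real.tendsto_sqrt_atTop.comp tendsto_natCast_atTop_atTop)
  have A' : Tendsto (fun n : ℕ => ∫ ω, Z (t / Real.sqrt n) n ω ∂μ) atTop (𝓝 1) := by
    rw [tendsto_iff_norm_sub_tendsto_zero]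
    refine squeeze_zero' (Eventually.of_forall fun n => norm_nonneg _) ?_
      (by simpa using hsq.const_mul (R * K * |t| ^ 3))
    filter_upwards [eventually_gt_atTop 0] with n hn using A n hn
  -- replace random normalisation by the deterministic one
  let c : ℝ := t ^ 2 / 2 * σ2
  let W : ℕ → Ω → ℂ := fun n ω =>
    Complex.exp (Complex.I * (t / Real.sqrt n : ℝ) * (MM Sp Xp d n ω : ℝ))
  let R' := Real.exp (t ^ 2 * D ^ 2 + |c|)
  have expLip : ∀ x y M : ℝ, x ≤ M → y ≤ M →
      |Real.exp x - Real.exp y| ≤ Real.exp M * |x - y| := by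
    have aux : ∀ x y M : ℝ, x ≤ M → y ≤ x →
        |Real.exp x - Real.exp y| ≤ Real.exp M * |x - y| := by
      intro x y M hx hyx
      rw [abs_of_nonneg (sub_nonneg.2 (Real.exp_le_exp.2 hyx)), abs_of_nonneg (sub_nonneg.2 hyx)]
      have h1 : Real.exp y = Real.exp x * Real.exp (y - x) := by rw [← Real.exp_add]; ring_nf
      have h2 := Real.add_one_le_exp (y - x)
      have h3 : Real.exp x ≤ Real.exp M := Real.exp_le_exp.2 hx
      have h4 := Real.exp_pos x
      calc Real.exp x - Real.exp y = Real.exp x * (1 - Real.exp (y - x)) := by rw [h1]; ring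
        _ ≤ Real.exp x * (x - y) := mul_le_mul_of_nonneg_left (by linarith) h4.le
        _ ≤ Real.exp M * (x - y) := by
          apply mul_le_mul_of_nonneg_right h3; linarith
    intro x y M hx hy
    rcases le_total y x with hh | hh
    · exact aux x y M hx hh
    · rw [abs_sub_comm, abs_sub_comm x y]; exact aux y x M hy hh
  have Wm : ∀ n, Measurable (W n) := fun n =>
    Complex.measurable_exp.comp ((Complex.measurable_ofReal.comp
      ((p.MM_meas hd.meas n).mono (F.le n) le_rfl)).const_mul _)
  have Wn : ∀ n ω, ‖W n ω‖ = 1 := by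
    intro n ω
    simp only [W, Complex.norm_exp]
    simp
  have bnd2 : ∀ n : ℕ, 0 < n → ∀ ω, ‖W n ω * Complex.exp (c : ℝ) - Z (t / Real.sqrt n) n ω‖
      ≤ R' * (t ^ 2 / 2) * |VV Sp Xp v n ω / n - σ2| := by
    intro n hn ω
    have hn' : (0 : ℝ) < n := by exact_mod_cast hn
    have e1 : W n ω * Complex.exp (c : ℝ) - Z (t / Real.sqrt n) n ω
        = W n ω * ((Real.exp c - Real.exp ((t / Real.sqrt n) ^ 2 / 2 * VV Sp Xp v n ω) : ℝ) : ℂ) := by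
      simp only [W, Z, Complex.exp_add]
      push_cast; ring
    have e2 : (t / Real.sqrt n) ^ 2 / 2 * VV Sp Xp v n ω = t ^ 2 / 2 * (VV Sp Xp v n ω / n) := by
      rw [div_pow, Real.sq_sqrt hn'.le]; field_simp
    rw [e1, norm_mul, Wn, one_mul, Complex.norm_real, Real.norm_eq_abs, e2]
    refine (expLip _ _ (t ^ 2 * D ^ 2 + |c|) ?_ ?_).trans (le_of_eq ?_)
    · have := le_abs_self c; have : 0 ≤ t ^ 2 * D ^ 2 := by positivity
      linarith
    · have h2 : VV Sp Xp v n ω / n ≤ D ^ 2 := by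
        rw [div_le_iff₀ hn']; linarith [hVV1 n ω]
      have h3 : t ^ 2 / 2 * (VV Sp Xp v n ω / n) ≤ t ^ 2 / 2 * D ^ 2 := by gcongr
      have : 0 ≤ t ^ 2 * D ^ 2 := by positivity
      have := abs_nonneg c
      linarith
    · have : c - t ^ 2 / 2 * (VV Sp Xp v n ω / n) = - (t ^ 2 / 2 * (VV Sp Xp v n ω / n - σ2)) := by
        simp only [c]; ring
      have h5 : |c - t ^ 2 / 2 * (VV Sp Xp v n ω / n)| = t ^ 2 / 2 * |VV Sp Xp v n ω / n - σ2| := by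
        rw [this, abs_neg, abs_mul, abs_of_nonneg (by positivity : 0 ≤ t ^ 2 / 2)]
      rw [h5]; simp only [R']; ring
  have VVm : ∀ n, Measurable (VV Sp Xp v n) := fun n => (p.VV_meas hvm n).mono (F.le n) le_rfl
  have Bt : Tendsto (fun n : ℕ => (∫ ω, W n ω ∂μ) * Complex.exp (c : ℝ)
      - ∫ ω, Z (t / Real.sqrt n) n ω ∂μ) atTop (𝓝 0) := by
    rw [tendsto_zero_iff_norm_tendsto_zero]
    refine squeeze_zero' (Eventually.of_forall fun n => norm_nonneg _) ?_
      (by simpa using hV.const_mul (R' * (t ^ 2 / 2)))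
    filter_upwards [eventually_gt_atTop 0] with n hn
    have iW : Integrable (W n) μ := Integrable.of_bound (Wm n).aestronglyMeasurable 1
      (ae_of_all _ fun ω => (Wn n ω).le)
    have iZ : Integrable (Z (t / Real.sqrt n) n) μ :=
      Integrable.of_bound ((Zm _ n).mono (F.le n) le_rfl).aestronglyMeasurable R
        (ae_of_all _ (ZR n hn n le_rfl))
    have iV : Integrable (fun ω => |VV Sp Xp v n ω / n - σ2|) μ := by
      have : BM (VV Sp Xp v n) (n * D ^ 2) := ⟨VVm n, VV_bound hv2 n⟩
      exact (((this.integrable μ).div_const _).sub (integrable_const _)).abs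
    rw [← integral_mul_const, ← integral_sub (iW.mul_const _) iZ, ← integral_const_mul]
    exact norm_integral_le_of_norm_le (iV.const_mul _) (ae_of_all _ (bnd2 n hn))
  have Ct : Tendsto (fun n : ℕ => (∫ ω, W n ω ∂μ) * Complex.exp (c : ℝ)) atTop (𝓝 1) := by
    simpa using Bt.add A'
  have := Ct.mul_const (Complex.exp ((-c : ℝ) : ℂ))
  refine (this.congr fun n => ?_).trans_eq ?_
  · rw [mul_assoc, ← Complex.exp_add]; simp [W]
  · simp [c]

end

end AdaptCLT

namespace AdaptCLT

section
variable {E X : Type*} [NormedAddCommGroup E] [MeasurableSpace E] [MeasurableSpace X]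
    {P : E → X → Measure X} {π : Measure X} {C ρ : ℝ}
variable {Ω : Type*} [mΩ : MeasurableSpace Ω] {μ : Measure Ω} [IsProbabilityMeasure μ]
  {F : Filtration ℕ mΩ} {Sp : ℕ → Ω → E} {Xp : ℕ → Ω → X}

theorem Proc.cesaro_l1 (p : Proc P μ F Sp Xp) {sinf : E}
    (hconv : ∀ᵐ ω ∂μ, Tendsto (fun k => Sp k ω) atTop (𝓝 sinf))
    {w : E × X → ℝ} (hw : Measurable w) {B K : ℝ} (hB : ∀ q, |w q| ≤ B)
    (hK : ∀ k ω, |w (Sp k ω, Xp k ω)| ≤ K * ‖Sp k ω - sinf‖) :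
    Tendsto (fun n : ℕ => (∫ ω, |VV Sp Xp w n ω| ∂μ) / n) atTop (𝓝 0) := by
  have bw : ∀ k, BM (fun ω => w (Sp k ω, Xp k ω)) B := fun k =>
    ⟨hw.comp ((p.adapted k).mono (F.le k) le_rfl), fun ω => hB _⟩
  have a0 : Tendsto (fun k => ∫ ω, |w (Sp k ω, Xp k ω)| ∂μ) atTop (𝓝 0) := by
    have := tendsto_integral_of_dominated_convergence (μ := μ)
      (F := fun k ω => |w (Sp k ω, Xp k ω)|) (f := fun _ => (0 : ℝ)) (fun _ => B)
      (fun k => (bw k).meas.abs.aestronglyMeasurable) (integrable_const _)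
      (fun k => ae_of_all _ fun ω => by
        rw [Real.norm_eq_abs, abs_abs]; exact hB _) ?_
    · simpa using this
    · filter_upwards [hconv] with ω hω
      have h1 : Tendsto (fun k => K * ‖Sp k ω - sinf‖) atTop (𝓝 0) := by
        have := (tendsto_iff_norm_sub_tendsto_zero.1 hω).const_mul K
        simpa using this
      exact squeeze_zero (fun k => abs_nonneg _) (fun k => hK k ω) h1
  refine squeeze_zero (fun n => ?_) (fun n => ?_) a0.cesaro
  · have : 0 ≤ ∫ ω, |VV Sp Xp w n ω| ∂μ := integral_nonneg fun _ => abs_nonneg _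
    positivity
  · rw [div_eq_inv_mul]
    refine mul_le_mul_of_nonneg_left ?_ (by positivity)
    rw [← integral_finsetSum _ fun k _ => ((bw k).integrable μ).abs]
    refine integral_mono ?_ (integrable_finsetSum _ fun k _ => ((bw k).integrable μ).abs)
      fun ω => Finset.abs_sum_le_sum_abs _ _
    exact (integrable_finsetSum _ fun k _ => (bw k).integrable μ).abs

theorem Proc.lln (h : Setup P π C ρ) (p : Proc P μ F Sp Xp) {Sset : Set E} {L : ℝ}
    (hA7 : ∀ s ∈ Sset, ∀ s' ∈ Sset, ∀ x, tvDist (P s x) (P s' x) ≤ L * ‖s - s'‖)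
    (hS : ∀ k ω, Sp k ω ∈ Sset) {sinf : E} (hsinf : sinf ∈ Sset)
    (hconv : ∀ᵐ ω ∂μ, Tendsto (fun k => Sp k ω) atTop (𝓝 sinf))
    {v : E × X → ℝ} (hvm : Measurable v) {B K : ℝ} (hB : ∀ q, |v q| ≤ B)
    (hK : ∀ s ∈ Sset, ∀ s' ∈ Sset, ∀ x, |v (s, x) - v (s', x)| ≤ K * ‖s - s'‖) :
    Tendsto (fun n : ℕ => ∫ ω, |VV Sp Xp v n ω / n - ∫ x, v (sinf, x) ∂π| ∂μ)
      atTop (𝓝 0) := by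
  set f : X → ℝ := fun x => v (sinf, x) with hf
  have bf : BM f B := ⟨hvm.comp measurable_prodMk_left, fun x => hB _⟩
  set g : X → ℝ := gfun P π f sinf with hg
  set G := 2 * (2 * B) * C / (1 - ρ) with hG
  have bg : BM g G := h.g_BM bf sinf
  let w1 : E × X → ℝ := fun q => v q - v (sinf, q.2)
  let w2 : E × X → ℝ := fun q => ∫ y, g y ∂(P q.1 q.2) - ∫ y, g y ∂(P sinf q.2)
  let d : E × X → X → ℝ := fun q y => g y - ∫ z, g z ∂(P q.1 q.2)
  have mPg : Measurable fun q : E × X => ∫ y, g y ∂(P q.1 q.2) :=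
    h.P_measJ (f := fun p => g p.2) (bg.meas.comp measurable_snd)
  have bPg : ∀ q : E × X, |∫ y, g y ∂(P q.1 q.2)| ≤ G := fun q => (h.P_BM q.1 bg).bound q.2
  have m1 : Measurable w1 := hvm.sub (bf.meas.comp measurable_snd)
  have m2 : Measurable w2 := mPg.sub ((h.P_BM sinf bg).meas.comp measurable_snd)
  have T1 := p.cesaro_l1 hconv m1 (B := B + B) (K := K)
    (fun q => (abs_sub _ _).trans (add_le_add (hB _) (hB _)))
    (fun k ω => hK _ (hS k ω) _ hsinf _)
  have T2 := p.cesaro_l1 hconv m2 (B := G + G) (K := 2 * G * L)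
    (fun q => (abs_sub _ _).trans (add_le_add (bPg _) (bPg (sinf, q.2))))
    (fun k ω => (h.P_lip hA7 bg (hS k ω) hsinf _).trans_eq (by ring))
  have hd : MD P d (G + G) := by
    refine ⟨?_, fun q y => (abs_sub _ _).trans (add_le_add (bg.bound _) (bPg _)), fun q => ?_⟩
    · exact (bg.meas.comp measurable_snd).sub (mPg.comp measurable_fst)
    · have := h.prob q.1 q.2
      simp only [d]
      rw [integral_sub (bg.integrable _) (integrable_const _)]; simp
  have T3 := Proc.MM_l1 h p hd
  have T4 : Tendsto (fun n : ℕ => (G + G) / (n : ℝ)) atTop (𝓝 0) :=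
    tendsto_const_div_atTop_nhds_zero_nat _
  have T := ((T1.add T2).add T3).add T4
  simp only [add_zero] at T
  refine squeeze_zero' (Eventually.of_forall fun n => integral_nonneg fun _ => abs_nonneg _) ?_ T
  filter_upwards [eventually_gt_atTop 0] with n hn
  have hn' : (0 : ℝ) < n := by exact_mod_cast hn
  have i1 : Integrable (VV Sp Xp w1 n) μ := (BM.mk ((p.VV_meas m1 n).mono (F.le n) le_rfl)
    (VV_bound (fun q => (abs_sub _ _).trans (add_le_add (hB _) (hB _))) n)).integrable μ
  have i2 : Integrable (VV Sp Xp w2 n) μ := (BM.mk ((p.VV_meas m2 n).mono (F.le n) le_rfl)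
    (VV_bound (fun q => (abs_sub _ _).trans (add_le_add (bPg _) (bPg (sinf, q.2)))) n)).integrable μ
  have i3 : Integrable (MM Sp Xp d n) μ := (BM.mk ((p.MM_meas hd.meas n).mono (F.le n) le_rfl)
    (MM_bound hd.bound n)).integrable μ
  have i0 : Integrable (VV Sp Xp v n) μ := (BM.mk ((p.VV_meas hvm n).mono (F.le n) le_rfl)
    (VV_bound hB n)).integrable μ
  have id : ∀ ω, VV Sp Xp v n ω - n * ∫ x, f x ∂π = VV Sp Xp w1 n ω + VV Sp Xp w2 n ω +
      MM Sp Xp d n ω + (g (Xp 0 ω) - g (Xp n ω)) := by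
    intro ω
    have e : ∀ m : ℕ, VV Sp Xp v m ω - m * ∫ x, f x ∂π = VV Sp Xp w1 m ω + VV Sp Xp w2 m ω +
      MM Sp Xp d m ω + (g (Xp 0 ω) - g (Xp m ω)) := by
      intro m
      induction m with
      | zero => simp [VV, MM]
      | succ m ih =>
        have hp := h.poisson bf sinf (Xp m ω)
        simp only [VV, MM] at ih ⊢
        simp only [Finset.sum_range_succ]
        have e1 : w1 (Sp m ω, Xp m ω) = v (Sp m ω, Xp m ω) - f (Xp m ω) := rfl
        have e2 : w2 (Sp m ω, Xp m ω) = ∫ y, g y ∂(P (Sp m ω) (Xp m ω)) - Pg P π f sinf (Xp m ω) := rfl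
        have e3 : d (Sp m ω, Xp m ω) (Xp (m+1) ω) = g (Xp (m+1) ω) -
          ∫ y, g y ∂(P (Sp m ω) (Xp m ω)) := rfl
        rw [e1, e2, e3]
        rw [← hg] at hp
        push_cast
        linarith
    exact e n
  have pt : ∀ ω, |VV Sp Xp v n ω / n - ∫ x, f x ∂π| ≤
      (|VV Sp Xp w1 n ω| + |VV Sp Xp w2 n ω| + |MM Sp Xp d n ω| + (G + G)) / n := by
    intro ω
    have : VV Sp Xp v n ω / n - ∫ x, f x ∂π = (VV Sp Xp v n ω - n * ∫ x, f x ∂π) / n := by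
      field_simp
    rw [this, abs_div, abs_of_pos hn', id]
    refine div_le_div_of_nonneg_right ?_ hn'.le
    refine (abs_add_le _ _).trans (add_le_add ((abs_add_le _ _).trans
      (add_le_add (abs_add_le _ _) le_rfl)) ?_)
    exact (abs_sub _ _).trans (add_le_add (bg.bound _) (bg.bound _))
  refine (integral_mono ((i0.div_const _).sub (integrable_const _)).abs
    ((((i1.abs.add i2.abs).add i3.abs).add (integrable_const _)).div_const _) pt).trans_eq ?_
  rw [integral_div]
  have j12 : Integrable (fun ω => |VV Sp Xp w1 n ω| + |VV Sp Xp w2 n ω|) μ := i1.abs.add i2.abs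
  have j123 : Integrable (fun ω => |VV Sp Xp w1 n ω| + |VV Sp Xp w2 n ω| + |MM Sp Xp d n ω|) μ :=
    j12.add i3.abs
  simp only [Pi.add_apply]
  rw [integral_add j123 (integrable_const _), integral_add j12 i3.abs, integral_add i1.abs i2.abs]
  simp
  ring

theorem kronecker {b : ℕ → ℝ} (hb : ∀ k, 0 ≤ b k)
    (hs : Summable fun k : ℕ => b k / Real.sqrt ((k : ℝ) + 1)) :
    Tendsto (fun n : ℕ => (∑ k ∈ Finset.range n, b k) / Real.sqrt n) atTop (𝓝 0) := by
  have key := tendsto_tsum_of_dominated_convergence (𝓕 := (atTop : Filter ℕ))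
    (f := fun (n k : ℕ) => if k < n then b k / Real.sqrt n else 0) (g := fun _ => (0 : ℝ))
    (bound := fun k : ℕ => b k / Real.sqrt ((k : ℝ) + 1)) hs ?_ ?_
  · rw [tsum_zero] at key
    refine key.congr fun n => ?_
    rw [tsum_eq_sum (s := Finset.range n), Finset.sum_div]
    · refine Finset.sum_congr rfl fun k hk => ?_
      rw [if_pos (Finset.mem_range.1 hk)]
    · intro k hk
      rw [if_neg (by simpa using hk)]
  · intro k
    have hsq : Tendsto (fun n : ℕ => b k * (Real.sqrt n)⁻¹) atTop (𝓝 0) := by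
      have := (tendsto_inv_atTop_zero.comp (Real.tendsto_sqrt_atTop.comp
        tendsto_natCast_atTop_atTop)).const_mul (b k) (M := ℝ) (α := ℕ)
      simpa using this
    refine hsq.congr' ?_
    filter_upwards [eventually_gt_atTop k] with n hn
    rw [if_pos hn, div_eq_mul_inv]
  · refine Eventually.of_forall fun n k => ?_
    split_ifs with hk
    · have : (k : ℝ) + 1 ≤ n := by exact_mod_cast hk
      have h1 : Real.sqrt ((k : ℝ) + 1) ≤ Real.sqrt n := Real.sqrt_le_sqrt this
      have h2 : 0 < Real.sqrt ((k : ℝ) + 1) := Real.sqrt_pos.2 (by positivity)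
      have := hb k
      rw [Real.norm_of_nonneg (by positivity)]
      gcongr
    · have := hb k
      rw [norm_zero]; positivity

/-- Transfer of characteristic functions along an `L¹`-negligible perturbation and Lévy. -/
theorem levy_transfer {M S Dn : ℕ → Ω → ℝ} {σ2 : ℝ} (hσ : 0 ≤ σ2)
    (hM : ∀ n, Measurable (M n)) (hS : ∀ n, Measurable (S n)) (hDi : ∀ n, Integrable (Dn n) μ)
    (hD : ∀ n ω, |S n ω - M n ω| ≤ Dn n ω)
    (hDt : Tendsto (fun n : ℕ => (∫ ω, Dn n ω ∂μ) / Real.sqrt n) atTop (𝓝 0))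
    (hc : ∀ t : ℝ, Tendsto (fun n : ℕ => ∫ ω, Complex.exp (Complex.I * (t / Real.sqrt n : ℝ) *
      (M n ω : ℝ)) ∂μ) atTop (𝓝 (Complex.exp ((-(t ^ 2 / 2 * σ2) : ℝ) : ℂ))))
    (f : BoundedContinuousFunction ℝ ℝ) :
    Tendsto (fun n : ℕ => ∫ ω, f (S n ω / Real.sqrt n) ∂μ) atTop
      (𝓝 (∫ x, f x ∂(gaussianReal 0 σ2.toNNReal))) := by
  have hSm : ∀ n : ℕ, Measurable fun ω => S n ω / Real.sqrt n := fun n => (hS n).div_const _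
  let ν : ℕ → ProbabilityMeasure ℝ := fun n =>
    ⟨μ.map fun ω => S n ω / Real.sqrt n, Measure.isProbabilityMeasure_map (hSm n).aemeasurable⟩
  let ν0 : ProbabilityMeasure ℝ := ⟨gaussianReal 0 σ2.toNNReal, inferInstance⟩
  have hcS : ∀ t : ℝ, Tendsto (fun n : ℕ => ∫ ω, Complex.exp (Complex.I * (t / Real.sqrt n : ℝ) *
      (S n ω : ℝ)) ∂μ) atTop (𝓝 (Complex.exp ((-(t ^ 2 / 2 * σ2) : ℝ) : ℂ))) := by
    intro t
    have hdiff : Tendsto (fun n : ℕ => (∫ ω, Complex.exp (Complex.I * (t / Real.sqrt n : ℝ) *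
      (S n ω : ℝ)) ∂μ) - ∫ ω, Complex.exp (Complex.I * (t / Real.sqrt n : ℝ) *
      (M n ω : ℝ)) ∂μ) atTop (𝓝 0) := by
      rw [tendsto_zero_iff_norm_tendsto_zero]
      refine squeeze_zero (fun n => norm_nonneg _) (fun n => ?_)
        (by simpa using hDt.const_mul |t|)
      have meas : ∀ {Y : Ω → ℝ}, Measurable Y → Integrable (fun ω =>
          Complex.exp (Complex.I * (t / Real.sqrt n : ℝ) * (Y ω : ℝ))) μ := by
        intro Y hY
        refine Integrable.of_bound (Complex.measurable_exp.comp ((Complex.measurable_ofReal.comp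
          hY).const_mul _)).aestronglyMeasurable 1 (ae_of_all _ fun ω => ?_)
        rw [Complex.norm_exp]; simp
      rw [← integral_sub (meas (hS n)) (meas (hM n))]
      have e : |t| * ((∫ ω, Dn n ω ∂μ) / Real.sqrt n) = ∫ ω, |t| / Real.sqrt n * Dn n ω ∂μ := by
        rw [integral_const_mul]; ring
      rw [e]
      refine norm_integral_le_of_norm_le ((hDi n).const_mul _) (ae_of_all _ fun ω => ?_)
      have e2 : Complex.exp (Complex.I * (t / Real.sqrt n : ℝ) * (S n ω : ℝ)) -
          Complex.exp (Complex.I * (t / Real.sqrt n : ℝ) * (M n ω : ℝ)) =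
          Complex.exp (Complex.I * (t / Real.sqrt n : ℝ) * (M n ω : ℝ)) *
          (Complex.exp (Complex.I * ((t / Real.sqrt n * (S n ω - M n ω) : ℝ) : ℂ)) - 1) := by
        rw [mul_sub, ← Complex.exp_add, mul_one]
        congr 2
        push_cast; ring
      have e3 : ‖Complex.exp (Complex.I * (t / Real.sqrt n : ℝ) * (M n ω : ℝ))‖ = 1 := by
        rw [Complex.norm_exp]; simp
      rw [e2, norm_mul, e3, one_mul]
      refine (Real.norm_exp_I_mul_ofReal_sub_one_le).trans ?_
      rw [Real.norm_eq_abs, abs_mul, abs_div, abs_of_nonneg (Real.sqrt_nonneg _)]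
      exact mul_le_mul_of_nonneg_left (hD n ω) (by positivity)
    simpa using hdiff.add (hc t)
  have hν : Tendsto ν atTop (𝓝 ν0) := by
    rw [ProbabilityMeasure.tendsto_iff_tendsto_charFun]
    intro t
    have e0 : charFun (ν0 : Measure ℝ) t = Complex.exp ((-(t ^ 2 / 2 * σ2) : ℝ) : ℂ) := by
      change charFun (gaussianReal 0 σ2.toNNReal) t = _
      rw [charFun_gaussianReal]
      congr 1
      have : ((σ2.toNNReal : ℝ) : ℂ) = (σ2 : ℂ) := by rw [Real.coe_toNNReal _ hσ]
      rw [this]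
      push_cast; ring
    rw [e0]
    refine (hcS t).congr fun n => ?_
    change _ = charFun (μ.map fun ω => S n ω / Real.sqrt n) t
    rw [charFun_apply_real, integral_map (hSm n).aemeasurable (by fun_prop)]
    congr 1; ext ω; congr 1
    push_cast; ring
  have := ProbabilityMeasure.tendsto_iff_forall_integral_tendsto.1 hν f
  refine this.congr fun n => ?_
  change ∫ x, f x ∂(μ.map fun ω => S n ω / Real.sqrt n) = _
  exact integral_map (hSm n).aemeasurable f.continuous.measurable.aestronglyMeasurable

end

end AdaptCLT
/-- Under (A1), (A2), (A7), for stochastic-approximation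
adaptation `S_k = S_{k-1} + γ_k H_k` with (i) `Σ_k (γ_k/√k) E[‖H_k‖] < ∞` and
(ii) `S_k → s_∞` almost surely, the central limit theorem holds:
`n^{-1/2} Σ_{k=1}^n (φ(X_k) − π(φ)) → N(0, σ_φ²)` in distribution, with
asymptotic variance `σ_φ² = π(g_{s_∞}² − (P_{s_∞} g_{s_∞})²) ∈ [0,∞)`. -/
theorem stmt14 {E X : Type*} [NormedAddCommGroup E] [NormedSpace ℝ E]
    [MeasurableSpace E] [BorelSpace E] [MeasurableSpace X]
    (P : E → X → Measure X) (π : Measure X) [IsProbabilityMeasure π]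
    (hPprob : ∀ s x, IsProbabilityMeasure (P s x))
    (hPmeas : ∀ A : Set X, MeasurableSet A → Measurable fun p : E × X => P p.1 p.2 A)
    (hinv : ∀ s, π.bind (P s) = π)
    (C ρ : ℝ) (hρ : ρ ∈ Set.Ico (0 : ℝ) 1)
    (hA2 : ∀ s x k, tvDist (iterK P s k x) π ≤ C * ρ ^ k)
    {Ω : Type*} [mΩ : MeasurableSpace Ω] (μ : Measure Ω) [IsProbabilityMeasure μ]
    (F : Filtration ℕ mΩ)
    (Sset : Set E) (Sp : ℕ → Ω → E) (Xp : ℕ → Ω → X)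
    (hSmem : ∀ k ω, Sp k ω ∈ Sset)
    (hadapted : ∀ k, Measurable[F k] fun ω => (Sp k ω, Xp k ω))
    (hmarkov : ∀ (k : ℕ) (A : Set X), MeasurableSet A →
      μ[fun ω => A.indicator (fun _ => (1 : ℝ)) (Xp (k + 1) ω) | F k]
        =ᵐ[μ] fun ω => (P (Sp k ω) (Xp k ω) A).toReal)
    (γ : ℕ → ℝ) (hγ : ∀ k, 0 < γ k)
    (H : ℕ → Ω → E) (hHmeas : ∀ k, Measurable[F k] (H k))
    (hHint : ∀ k, Integrable (fun ω => ‖H k ω‖) μ)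
    (hSA : ∀ k, 1 ≤ k → ∀ ω, Sp k ω = Sp (k - 1) ω + γ k • H k ω)
    (L : ℝ)
    (hA7 : ∀ s ∈ Sset, ∀ s' ∈ Sset, ∀ x, tvDist (P s x) (P s' x) ≤ L * ‖s - s'‖)
    (φ : X → ℝ) (hφm : Measurable φ) (hφb : ∃ B, ∀ x, |φ x| ≤ B)
    (hsum : Summable fun k : ℕ =>
      γ (k + 1) / Real.sqrt ((k : ℝ) + 1) * ∫ ω, ‖H (k + 1) ω‖ ∂μ)
    (sinf : E) (hsinf : sinf ∈ Sset)
    (hconv : ∀ᵐ ω ∂μ, Tendsto (fun k => Sp k ω) atTop (𝓝 sinf)) :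
    0 ≤ ∫ x, (gfun P π φ sinf x ^ 2 - Pg P π φ sinf x ^ 2) ∂π ∧
    ∀ f : BoundedContinuousFunction ℝ ℝ,
      Tendsto (fun n : ℕ => ∫ ω, f ((∑ k ∈ Finset.Icc 1 n,
          (φ (Xp k ω) - ∫ x, φ x ∂π)) / Real.sqrt n) ∂μ)
        atTop (𝓝 (∫ x, f x ∂(gaussianReal 0
          (∫ x, (gfun P π φ sinf x ^ 2 - Pg P π φ sinf x ^ 2) ∂π).toNNReal))) := by
  classical
  obtain ⟨B, hB⟩ := hφb
  have bφ : AdaptCLT.BM φ B := ⟨hφm, hB⟩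
  have h : AdaptCLT.Setup P π |C| ρ := by
    refine ⟨inferInstance, hPprob, hPmeas, hinv, hρ, abs_nonneg _, fun s x k => ?_⟩
    exact (hA2 s x k).trans (mul_le_mul_of_nonneg_right (le_abs_self C) (pow_nonneg hρ.1 k))
  have p : AdaptCLT.Proc P μ F Sp Xp := ⟨hadapted, hmarkov⟩
  have hσ : 0 ≤ ∫ x, (gfun P π φ sinf x ^ 2 - Pg P π φ sinf x ^ 2) ∂π := by
    rw [← h.vv_mean bφ sinf]
    exact integral_nonneg fun x => h.vv_nonneg bφ _
  refine ⟨hσ, ?_⟩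
  set G := 2 * (2 * B) * |C| / (1 - ρ) with hG
  have bg : ∀ s x, |gfun P π φ s x| ≤ G := fun s => (h.g_BM bφ s).bound
  have bPg : ∀ s x, |Pg P π φ s x| ≤ G := fun s => (h.P_BM s (h.g_BM bφ s)).bound
  obtain ⟨K, hK⟩ := h.vv_lip hA7 bφ
  have lln := AdaptCLT.Proc.lln h p hA7 hSmem hsinf hconv (h.vv_measJ bφ) (B := G ^ 2) (K := K)
    (fun q => by rw [abs_of_nonneg (h.vv_nonneg bφ q)]; exact h.vv_le bφ q) hK
  rw [h.vv_mean bφ sinf] at lln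
  let d : E × X → X → ℝ := fun q y => gfun P π φ q.1 y - Pg P π φ q.1 q.2
  have hd : AdaptCLT.MD P d (G + G) := by
    refine ⟨?_, fun q y => (abs_sub _ _).trans (add_le_add (bg _ _) (bPg _ _)), fun q => ?_⟩
    · exact ((h.g_measJ bφ).comp ((measurable_fst.comp measurable_fst).prodMk measurable_snd)).sub
        ((h.Pg_measJ bφ).comp measurable_fst)
    · have := h.prob q.1 q.2
      simp only [d]
      rw [integral_sub ((h.g_BM bφ q.1).integrable _) (integrable_const _)]
      simp [Pg]
  have hc := AdaptCLT.Proc.clt_char h p hd (h.vv_measJ bφ) (fun q => h.vv_eq bφ q) lln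
  obtain ⟨K', hK'⟩ := h.g_lip hA7 bφ
  let Dn : ℕ → Ω → ℝ := fun n ω =>
    (2 * B + 2 * B + (G + G)) + |K'| * ∑ k ∈ Finset.range n, γ (k + 1) * ‖H (k + 1) ω‖
  have bφ' := (h.centered bφ).1.bound
  have mX : ∀ k, Measurable (Xp k) := fun k => (p.measX k).mono (F.le k) le_rfl
  have iH : ∀ n, Integrable (fun ω => ∑ k ∈ Finset.range n, γ (k + 1) * ‖H (k + 1) ω‖) μ :=
    fun n => integrable_finsetSum _ fun k _ => (hHint (k + 1)).const_mul _
  refine AdaptCLT.levy_transfer (M := AdaptCLT.MM Sp Xp d) (Dn := Dn) hσ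
    (fun n => (p.MM_meas hd.meas n).mono (F.le n) le_rfl) (fun n => ?_) (fun n => ?_) ?_ ?_ hc
  · exact Finset.measurable_sum _ fun k _ => (hφm.comp (mX k)).sub_const _
  · exact (integrable_const _).add ((iH n).const_mul _)
  · intro n ω
    have e : ∀ m : ℕ, ∑ k ∈ Finset.Icc 1 m, (φ (Xp k ω) - ∫ x, φ x ∂π) =
        AdaptCLT.MM Sp Xp d m ω + ((φ (Xp m ω) - ∫ x, φ x ∂π) - (φ (Xp 0 ω) - ∫ x, φ x ∂π)) +
        (gfun P π φ (Sp 0 ω) (Xp 0 ω) - gfun P π φ (Sp m ω) (Xp m ω)) +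
        ∑ k ∈ Finset.range m, (gfun P π φ (Sp (k + 1) ω) (Xp (k + 1) ω) -
          gfun P π φ (Sp k ω) (Xp (k + 1) ω)) := by
      intro m
      induction m with
      | zero => simp [AdaptCLT.MM]
      | succ m ih =>
        rw [Finset.sum_Icc_succ_top (by omega), ih, Finset.sum_range_succ]
        have hp := h.poisson bφ (Sp m ω) (Xp m ω)
        have e1 : AdaptCLT.MM Sp Xp d (m + 1) ω = AdaptCLT.MM Sp Xp d m ω +
            (gfun P π φ (Sp m ω) (Xp (m + 1) ω) - Pg P π φ (Sp m ω) (Xp m ω)) := by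
          simp only [AdaptCLT.MM, Finset.sum_range_succ, d]
        rw [e1]
        linarith
    rw [e n]
    have r : |∑ k ∈ Finset.range n, (gfun P π φ (Sp (k + 1) ω) (Xp (k + 1) ω) -
          gfun P π φ (Sp k ω) (Xp (k + 1) ω))| ≤
        |K'| * ∑ k ∈ Finset.range n, γ (k + 1) * ‖H (k + 1) ω‖ := by
      rw [Finset.mul_sum]
      refine (Finset.abs_sum_le_sum_abs _ _).trans (Finset.sum_le_sum fun k _ => ?_)
      refine (hK' _ (hSmem (k + 1) ω) _ (hSmem k ω) _).trans ?_
      have e1 : ‖Sp (k + 1) ω - Sp k ω‖ = γ (k + 1) * ‖H (k + 1) ω‖ := by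
        rw [hSA (k + 1) (by omega) ω, Nat.add_sub_cancel, add_sub_cancel_left, norm_smul,
          Real.norm_of_nonneg (hγ _).le]
      rw [e1]
      exact mul_le_mul_of_nonneg_right (le_abs_self _)
        (mul_nonneg (hγ _).le (norm_nonneg _))
    have a1 := abs_le.1 (bφ' (Xp n ω))
    have a2 := abs_le.1 (bφ' (Xp 0 ω))
    have a3 := abs_le.1 (bg (Sp 0 ω) (Xp 0 ω))
    have a4 := abs_le.1 (bg (Sp n ω) (Xp n ω))
    have a5 := abs_le.1 r
    simp only [Dn]
    rw [abs_le]
    constructor <;> linarith [a1.1, a1.2, a2.1, a2.2, a3.1, a3.2, a4.1, a4.2, a5.1, a5.2]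
  · have kr := AdaptCLT.kronecker (b := fun k => γ (k + 1) * ∫ ω, ‖H (k + 1) ω‖ ∂μ)
      (fun k => mul_nonneg (hγ _).le (integral_nonneg fun _ => norm_nonneg _))
      (hsum.congr fun k => by ring)
    have sq0 : Tendsto (fun n : ℕ => (2 * B + 2 * B + (G + G)) * (Real.sqrt n)⁻¹) atTop (𝓝 0) := by
      have := (tendsto_inv_atTop_zero.comp (Real.tendsto_sqrt_atTop.comp
        tendsto_natCast_atTop_atTop)).const_mul (2 * B + 2 * B + (G + G)) (M := ℝ) (α := ℕ)
      simpa using this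
    have tot := sq0.add (kr.const_mul |K'|)
    rw [mul_zero, add_zero] at tot
    refine tot.congr fun n => ?_
    simp only [Dn]
    rw [integral_add (integrable_const _) ((iH n).const_mul _), integral_const_mul,
      integral_finsetSum _ fun k _ => (hHint (k + 1)).const_mul _]
    simp_rw [integral_const_mul]
    simp
    ring
end

section
/- Assume (A1) and (A2), define the change events C_k = {S_k ≠ S_{k−1}} and adaptation times τ_j, and suppose that either Σ_{k=1}^∞ ℙ(C_k)/k < ∞ or Σ_{j=1}^∞ E[τ_j^{−1}] < ∞. Then for any bounded measurable φ: X → ℝ, the strong law of large numbers holds: (1/n) Σ_{k=1}^n φ(X_k) → π(φ) almost surely. -/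
open MeasureTheory Filter Finset ProbabilityTheory
open scoped ENNReal NNReal Topology

/-- The adaptation times: `tau Sp j ω` is the `j`-th time `k ≥ 1` at which
`Sp k ω ≠ Sp (k-1) ω`, with value `⊤` if there is no such time. -/
noncomputable def tau {Ω S : Type*} (Sp : ℕ → Ω → S) : ℕ → Ω → ℕ∞
  | 0, _ => 0
  | j + 1, ω => ⨅ (k : ℕ) (_ : tau Sp j ω < (k : ℕ∞)) (_ : Sp k ω ≠ Sp (k - 1) ω), (k : ℕ∞)

theorem kronecker_aux {x : ℕ → ℝ} {L : ℝ}
    (hx : Tendsto (fun n => ∑ i ∈ range n, x i / ((i : ℝ) + 1)) atTop (𝓝 L)) :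
    Tendsto (fun n : ℕ => (∑ i ∈ range n, x i) / n) atTop (𝓝 0) := by
  set s : ℕ → ℝ := fun n => ∑ i ∈ range n, x i / ((i : ℝ) + 1) with hs
  have key : ∀ n : ℕ, ∑ i ∈ range n, x i = n * s n - ∑ i ∈ range n, s i := by
    intro n
    induction n with
    | zero => simp
    | succ n ih =>
      have h1 : s (n + 1) = s n + x n / ((n : ℝ) + 1) := by simp [hs, sum_range_succ]
      have h2 : (n : ℝ) + 1 ≠ 0 := by positivity
      rw [sum_range_succ, sum_range_succ, ih, h1]
      push_cast
      field_simp
      ring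
  have h3 := hx.sub hx.cesaro
  rw [sub_self] at h3
  refine h3.congr' ?_
  filter_upwards [eventually_gt_atTop 0] with n hn
  have hn' : (n : ℝ) ≠ 0 := by positivity
  rw [key]
  change s n - (n : ℝ)⁻¹ * ∑ i ∈ range n, s i = _
  field_simp

theorem tau_le_aux {Ω S : Type*} (Sp : ℕ → Ω → S) (ω : Ω) (D : ℕ → Prop) [DecidablePred D]
    (hD : ∀ k, D k → Sp (k + 1) ω ≠ Sp k ω) (k : ℕ) :
    ∀ j, j ≤ ∑ i ∈ range k, (if D i then 1 else 0) → tau Sp j ω ≤ k := by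
  induction k with
  | zero => intro j hj; simp at hj; subst hj; simp [tau]
  | succ k ih =>
    intro j hj
    rw [sum_range_succ] at hj
    by_cases hk : D k
    · rcases j with _ | j
      · simp [tau]
      · simp only [hk, if_true] at hj
        have h1 := ih j (by omega)
        rw [tau]
        refine iInf_le_of_le (k + 1) (iInf_le_of_le ?_ (iInf_le_of_le ?_ le_rfl))
        · exact lt_of_le_of_lt h1 (by exact_mod_cast Nat.lt_succ_self k)
        · simpa using hD k hk
    · simp only [hk, if_false, add_zero] at hj
      refine (ih j hj).trans (by exact_mod_cast Nat.le_succ k)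

open Classical in
theorem summable_aux {Ω S : Type*} [MeasurableSpace Ω] (μ : Measure Ω)
    (Sp : ℕ → Ω → S) (D : ℕ → Set Ω) (hDm : ∀ k, MeasurableSet (D k))
    (hD : ∀ k, ∀ ω ∈ D k, Sp (k + 1) ω ≠ Sp k ω)
    (h : (∑' k : ℕ, μ {ω | Sp (k + 1) ω ≠ Sp k ω} / ((k : ℝ≥0∞) + 1)) ≠ ∞ ∨
         (∑' j : ℕ, ∫⁻ ω, ((tau Sp (j + 1) ω : ℝ≥0∞))⁻¹ ∂μ) ≠ ∞) :
    ∀ᵐ ω ∂μ, (∑' k : ℕ, (D k).indicator (fun _ => ((k : ℝ≥0∞) + 1)⁻¹) ω) < ∞ := by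
  have hm : ∀ k : ℕ, Measurable ((D k).indicator (fun _ : Ω => ((k : ℝ≥0∞) + 1)⁻¹)) :=
    fun k => measurable_const.indicator (hDm k)
  refine ae_lt_top (Measurable.tsum hm) ?_
  rcases h with h | h
  · rw [lintegral_tsum (fun k => (hm k).aemeasurable)]
    refine ne_top_of_le_ne_top h (ENNReal.tsum_le_tsum fun k => ?_)
    rw [lintegral_indicator_const (hDm k), ENNReal.div_eq_inv_mul]
    exact mul_le_mul_right (measure_mono (fun ω hω => hD k ω hω)) _
  · set N : ℕ → Ω → ℕ := fun k ω => ∑ i ∈ range k, (if ω ∈ D i then 1 else 0) with hN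
    have hNm : ∀ k, Measurable (N k) := fun k =>
      Finset.measurable_sum _ fun i _ => Measurable.ite (hDm i) measurable_const measurable_const
    set H : ℕ → ℕ → Ω → ℝ≥0∞ := fun j k =>
      (D k ∩ N k ⁻¹' {j}).indicator (fun _ => ((k : ℝ≥0∞) + 1)⁻¹) with hH
    have hHm : ∀ j k, Measurable (H j k) := fun j k =>
      measurable_const.indicator ((hDm k).inter (hNm k (measurableSet_singleton j)))
    have h1 : ∀ ω, (∑' k : ℕ, (D k).indicator (fun _ => ((k : ℝ≥0∞) + 1)⁻¹) ω)
        = ∑' j, ∑' k, H j k ω := by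
      intro ω
      rw [ENNReal.tsum_comm]
      refine tsum_congr fun k => ?_
      rw [tsum_eq_single (N k ω)]
      · simp [hH, Set.indicator]
      · intro j hj
        simp [hH, Set.indicator, hj.symm]
    have h2 : ∀ j ω, ∑' k, H j k ω ≤ ((tau Sp (j + 1) ω : ℝ≥0∞))⁻¹ := by
      intro j ω
      by_cases hex : ∃ k, ω ∈ D k ∧ N k ω = j
      · obtain ⟨k, hk, hkj⟩ := hex
        have hmono : ∀ a b, a < b → ω ∈ D a → N a ω < N b ω := by
          intro a b hab ha
          calc N a ω < N (a + 1) ω := by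
                simp only [hN]
                rw [sum_range_succ, if_pos ha]
                exact Nat.lt_succ_self _
            _ ≤ N b ω := by
              refine Finset.sum_le_sum_of_subset ?_
              intro x hx; simp at hx ⊢; omega
        rw [tsum_eq_single k]
        · have h3 : tau Sp (j + 1) ω ≤ ((k + 1 : ℕ) : ℕ∞) := by
            refine tau_le_aux Sp ω (fun k => ω ∈ D k) (fun k => hD k ω) (k + 1) (j + 1) ?_
            rw [sum_range_succ]
            simp only [hk, if_true]
            rw [← hkj]
          refine (Set.indicator_le_self' (by simp) ω).trans ?_
          refine ENNReal.inv_le_inv' ?_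
          have := ENat.toENNReal_le.mpr h3
          simpa using this
        · intro k' hk'
          refine Set.indicator_of_notMem ?_ _
          rintro ⟨h4, h5⟩
          simp at h5
          rcases lt_or_gt_of_ne hk' with h6 | h6
          · have := hmono _ _ h6 h4; omega
          · have := hmono _ _ h6 hk; omega
      · push Not at hex
        have : ∀ k, H j k ω = 0 := by
          intro k
          refine Set.indicator_of_notMem ?_ _
          rintro ⟨h4, h5⟩
          exact hex k h4 h5
        simp [this]
    simp_rw [h1]
    rw [lintegral_tsum (fun j => (Measurable.tsum (hHm j)).aemeasurable)]
    exact ne_top_of_le_ne_top h (ENNReal.tsum_le_tsum fun j => lintegral_mono (h2 j))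

theorem tv_aux {X : Type*} [MeasurableSpace X] (ν π : Measure X) [IsProbabilityMeasure ν]
    [IsProbabilityMeasure π] (φ : X → ℝ) (hφ : Measurable φ) {B : ℝ} (hB : ∀ x, |φ x| ≤ B) :
    |∫ x, φ x ∂ν - ∫ x, φ x ∂π| ≤ 2 * B * tvDist ν π := by
  have hle : ∀ A, MeasurableSet A → |ν.real A - π.real A| ≤ tvDist ν π := by
    intro A hA
    refine le_ciSup (f := fun A : {A : Set X // MeasurableSet A} =>
      |(ν A.1).toReal - (π A.1).toReal|) ?_ ⟨A, hA⟩
    refine ⟨1, ?_⟩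
    rintro _ ⟨A, rfl⟩
    have h1 := measureReal_le_one (μ := ν) (s := A.1)
    have h2 := measureReal_le_one (μ := π) (s := A.1)
    have h3 := measureReal_nonneg (μ := ν) (s := A.1)
    have h4 := measureReal_nonneg (μ := π) (s := A.1)
    change |ν.real A.1 - π.real A.1| ≤ 1
    rw [abs_le]; constructor <;> linarith
  have hne : Nonempty X := π.nonempty_of_neZero
  have hB0 : 0 ≤ B := (abs_nonneg _).trans (hB hne.some)
  have hi : ∀ m : Measure X, IsProbabilityMeasure m → Integrable φ m := fun m _ =>
    Integrable.of_bound hφ.aestronglyMeasurable B (ae_of_all _ hB)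
  have hrep : ∀ m : Measure X, IsProbabilityMeasure m →
      ∫ x, φ x ∂m + B = ∫ t in Set.Ioc 0 (2 * B), m.real {a | t < φ a + B} := by
    intro m hm
    have h1 : ∫ x, (φ x + B) ∂m = ∫ x, φ x ∂m + B := by
      rw [integral_add (hi m hm) (integrable_const _)]; simp
    rw [← h1, Integrable.integral_eq_integral_meas_lt (f := fun x => φ x + B)
      ((hi m hm).add (integrable_const B))
      (ae_of_all _ fun x => by have := (abs_le.mp (hB x)).1; simp; linarith)]
    refine setIntegral_eq_of_subset_of_forall_sdiff_eq_zero measurableSet_Ioi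
      Set.Ioc_subset_Ioi_self ?_
    intro t ht
    simp only [Set.mem_sdiff, Set.mem_Ioi, Set.mem_Ioc, not_and, not_le] at ht
    have h2 := ht.2 ht.1
    have : {a | t < φ a + B} = ∅ := by
      ext a
      have := (abs_le.mp (hB a)).2
      simp; linarith
    rw [this]; simp
  have hint : ∀ m : Measure X, IsProbabilityMeasure m →
      IntegrableOn (fun t => m.real {a | t < φ a + B}) (Set.Ioc 0 (2 * B)) := by
    intro m hm
    refine Measure.integrableOn_of_bounded (M := 1) measure_Ioc_lt_top.ne ?_ ?_
    · refine Measurable.aestronglyMeasurable ?_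
      refine Antitone.measurable ?_
      intro s t hst
      refine measureReal_mono ?_
      intro a ha
      exact lt_of_le_of_lt hst ha
    · refine ae_of_all _ fun t => ?_
      rw [Real.norm_of_nonneg measureReal_nonneg]
      exact measureReal_le_one
  have h5 : ∫ x, φ x ∂ν - ∫ x, φ x ∂π = ∫ t in Set.Ioc 0 (2 * B),
      (ν.real {a | t < φ a + B} - π.real {a | t < φ a + B}) := by
    rw [integral_sub (hint ν inferInstance) (hint π inferInstance), ← hrep ν inferInstance,
      ← hrep π inferInstance]
    ring
  rw [h5, ← Real.norm_eq_abs]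
  refine (norm_setIntegral_le_of_norm_le_const (C := tvDist ν π) measure_Ioc_lt_top ?_).trans ?_
  · intro t _
    exact hle _ (measurableSet_lt measurable_const (hφ.add_const B))
  · simp [Measure.real, hB0, mul_comm]

theorem iterK_meas_aux {S X : Type*} [MeasurableSpace S] [MeasurableSpace X]
    (P : S → X → Measure X) (hPprob : ∀ s x, IsProbabilityMeasure (P s x))
    (hPmeas : Measurable fun p : S × X => P p.1 p.2) (k : ℕ) :
    (Measurable fun p : S × X => iterK P p.1 k p.2) ∧
      ∀ s x, IsProbabilityMeasure (iterK P s k x) := by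
  induction k with
  | zero =>
    refine ⟨Measure.measurable_dirac.comp measurable_snd, fun s x => ?_⟩
    simp only [iterK]; infer_instance
  | succ k ih =>
    obtain ⟨ih1, ih2⟩ := ih
    have hsec : ∀ s, Measurable (iterK P s k) := fun s =>
      ih1.comp (measurable_const.prodMk measurable_id : Measurable fun y : X => (s, y))
    refine ⟨?_, fun s x => ?_⟩
    · let κ : Kernel (S × X) X := ⟨fun p => P p.1 p.2, hPmeas⟩
      have : IsMarkovKernel κ := ⟨fun p => hPprob p.1 p.2⟩
      refine Measure.measurable_of_measurable_coe _ fun A hA => ?_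
      have h1 : ∀ p : S × X, iterK P p.1 (k + 1) p.2 A = ∫⁻ y, iterK P p.1 k y A ∂(κ p) := by
        intro p
        simp only [iterK]
        rw [Measure.bind_apply hA (hsec p.1).aemeasurable]
        rfl
      simp_rw [h1]
      refine Measurable.lintegral_kernel_prod_right' (κ := κ)
        (f := fun q : (S × X) × X => iterK P q.1.1 k q.2 A) ?_
      have h2 : Measurable fun p : S × X => iterK P p.1 k p.2 A :=
        (Measure.measurable_coe hA).comp ih1
      exact h2.comp ((measurable_fst.comp measurable_fst).prodMk measurable_snd)
    · simp only [iterK]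
      have := hPprob s x
      refine ⟨?_⟩
      rw [Measure.bind_apply MeasurableSet.univ (hsec s).aemeasurable]
      have : ∀ y, iterK P s k y Set.univ = 1 := fun y => (ih2 s y).measure_univ
      simp [this]

/-- Everything about the Poisson equation that is needed. -/
theorem poisson_aux {S X : Type*} [MeasurableSpace S] [MeasurableSpace X]
    (P : S → X → Measure X) (π : Measure X) [IsProbabilityMeasure π]
    (hPprob : ∀ s x, IsProbabilityMeasure (P s x))
    (hPmeas : Measurable fun p : S × X => P p.1 p.2)
    (C ρ : ℝ) (hρ : ρ ∈ Set.Ico (0 : ℝ) 1)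
    (hA2 : ∀ s x k, tvDist (iterK P s k x) π ≤ C * ρ ^ k)
    (φ : X → ℝ) (hφm : Measurable φ) (hφb : ∃ B, ∀ x, |φ x| ≤ B) :
    ∃ (g : S × X → ℝ) (G : ℝ), Measurable g ∧ (∀ p, |g p| ≤ G) ∧
      ∀ s x, g (s, x) = (φ x - ∫ z, φ z ∂π) + ∫ y, g (s, y) ∂(P s x) := by
  obtain ⟨B, hB⟩ := hφb
  have hne : Nonempty X := π.nonempty_of_neZero
  have hB0 : 0 ≤ B := (abs_nonneg _).trans (hB hne.some)
  set c := ∫ z, φ z ∂π with hc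
  have hi : ∀ m : Measure X, IsProbabilityMeasure m → Integrable φ m := fun m _ =>
    Integrable.of_bound hφm.aestronglyMeasurable B (ae_of_all _ hB)
  let T : ℕ → S × X → ℝ := fun k p => ∫ y, (φ y - c) ∂(iterK P p.1 k p.2)
  have hk := iterK_meas_aux P hPprob hPmeas
  have hTm : ∀ k, Measurable (T k) := by
    intro k
    let κ : Kernel (S × X) X := ⟨fun p => iterK P p.1 k p.2, (hk k).1⟩
    exact (StronglyMeasurable.integral_kernel (κ := κ)
      (hφm.sub_const c).stronglyMeasurable).measurable
  have hTb : ∀ k p, ‖T k p‖ ≤ 2 * B * |C| * ρ ^ k := by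
    intro k p
    have := (hk k).2 p.1 p.2
    have h1 : T k p = ∫ y, φ y ∂(iterK P p.1 k p.2) - c := by
      simp only [T]
      rw [integral_sub (hi _ inferInstance) (integrable_const _)]; simp
    rw [h1, Real.norm_eq_abs]
    refine (tv_aux _ π φ hφm hB).trans ?_
    have h2 := hA2 p.1 p.2 k
    have h3 : C * ρ ^ k ≤ |C| * ρ ^ k :=
      mul_le_mul_of_nonneg_right (le_abs_self C) (pow_nonneg hρ.1 k)
    calc _ ≤ 2 * B * (|C| * ρ ^ k) :=
          mul_le_mul_of_nonneg_left (h2.trans h3) (by positivity)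
      _ = _ := by ring
  have hsum : Summable fun k : ℕ => 2 * B * |C| * ρ ^ k :=
    (summable_geometric_of_lt_one hρ.1 hρ.2).mul_left _
  have hTs : ∀ p, Summable fun k => T k p := fun p =>
    Summable.of_norm_bounded hsum (fun k => hTb k p)
  have hrec : ∀ k s x, T (k + 1) (s, x) = ∫ y, T k (s, y) ∂(P s x) := by
    intro k s x
    let η : Kernel X X := ⟨iterK P s k,
      (hk k).1.comp (measurable_const.prodMk measurable_id : Measurable fun y : X => (s, y))⟩
    have := (hk (k + 1)).2 s x
    have h1 : iterK P s (k + 1) x = (η ∘ₖ Kernel.const Unit (P s x)) () := by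
      rw [← Measure.comp_eq_comp_const_apply]; rfl
    simp only [T]
    have h2 : Integrable (fun y => φ y - c) (iterK P s (k + 1) x) :=
      (hi _ inferInstance).sub (integrable_const c)
    rw [h1] at h2 ⊢
    rw [Kernel.integral_comp h2]
    rfl
  refine ⟨fun p => ∑' k, T k p, ∑' k : ℕ, 2 * B * |C| * ρ ^ k, Measurable.tsum hTm,
    fun p => tsum_of_norm_bounded hsum.hasSum (fun k => hTb k p), ?_⟩
  intro s x
  have := hPprob s x
  have hsecm : ∀ k, Measurable fun y => T k (s, y) := fun k =>
      (hTm k).comp (measurable_const.prodMk measurable_id : Measurable fun y : X => (s, y))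
  have hint : ∀ k, Integrable (fun y => T k (s, y)) (P s x) := fun k =>
    Integrable.of_bound (hsecm k).aestronglyMeasurable _ (ae_of_all _ fun y => hTb k (s, y))
  have h0 : T 0 (s, x) = φ x - c := by
    simp only [T, iterK]
    exact integral_dirac' _ _ (hφm.sub_const c).stronglyMeasurable
  simp only
  rw [(hTs (s, x)).tsum_eq_zero_add, h0]
  congr 1
  simp_rw [hrec]
  refine integral_tsum_of_summable_integral_norm hint ?_
  refine Summable.of_nonneg_of_le (fun k => integral_nonneg fun y => norm_nonneg _) (fun k => ?_) hsum
  refine (integral_mono (hint k).norm (integrable_const _) (fun y => hTb k (s, y))).trans ?_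
  simp

theorem condExp_aux {S X : Type*} [MeasurableSpace S] [MeasurableSpace X]
    (P : S → X → Measure X) (hPprob : ∀ s x, IsProbabilityMeasure (P s x))
    (hPmeas : Measurable fun p : S × X => P p.1 p.2)
    {Ω : Type*} (m : MeasurableSpace Ω) [mΩ : MeasurableSpace Ω] (μ : Measure Ω)
    [IsProbabilityMeasure μ] (hm : m ≤ mΩ) (Z : Ω → S × X) (Y : Ω → X)
    (hZ : Measurable[m] Z) (hY : Measurable Y)
    (hmarkov : ∀ (A : Set X), MeasurableSet A →
      μ[fun ω => A.indicator (fun _ => (1 : ℝ)) (Y ω) | m]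
        =ᵐ[μ] fun ω => (P (Z ω).1 (Z ω).2 A).toReal)
    (g : S × X → ℝ) (hg : Measurable g) (G : ℝ) (hG : ∀ p, |g p| ≤ G) :
    μ[fun ω => g ((Z ω).1, Y ω) | m] =ᵐ[μ]
      fun ω => ∫ y, g ((Z ω).1, y) ∂(P (Z ω).1 (Z ω).2) := by
  have hZ' : Measurable Z := hZ.mono hm le_rfl
  let κ : Kernel (S × X) X := ⟨fun p => P p.1 p.2, hPmeas⟩
  have : IsMarkovKernel κ := ⟨fun p => hPprob p.1 p.2⟩
  let f : (S × X) × X → ℝ := fun q => g (q.1.1, q.2)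
  have hf : Measurable f := hg.comp ((measurable_fst.comp measurable_fst).prodMk measurable_snd)
  have hK : StronglyMeasurable fun p : S × X => ∫ y, f (p, y) ∂(κ p) :=
    StronglyMeasurable.integral_kernel_prod_right' hf.stronglyMeasurable
  have hKb : ∀ p : S × X, ‖∫ y, f (p, y) ∂(κ p)‖ ≤ G := by
    intro p
    refine (norm_integral_le_of_norm_le_const (ae_of_all _ fun y => hG _)).trans ?_
    simp
  have hKi : Integrable (fun ω => ∫ y, f (Z ω, y) ∂(κ (Z ω))) μ :=
    Integrable.of_bound (hK.comp_measurable hZ').aestronglyMeasurable G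
      (ae_of_all _ fun ω => hKb (Z ω))
  have hZY : Measurable fun ω => (Z ω, Y ω) := hZ'.prodMk hY
  symm
  refine ae_eq_condExp_of_forall_setIntegral_eq hm ?_ (fun s _ _ => hKi.integrableOn) ?_ ?_
  · exact Integrable.of_bound (hf.comp hZY).aestronglyMeasurable G (ae_of_all _ fun ω => hG _)
  · intro E hE _
    have hE' : MeasurableSet E := hm E hE
    have key : (μ.restrict E).map (fun ω => (Z ω, Y ω)) = ((μ.restrict E).map Z) ⊗ₘ κ := by
      refine Measure.ext_prod ?_
      intro B A hB hA
      rw [Measure.compProd_apply_prod hB hA, Measure.map_apply hZY (hB.prod hA),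
        setLIntegral_map hB (Kernel.measurable_coe κ hA) hZ']
      rw [Measure.restrict_restrict (hZ' hB)]
      have hEB : MeasurableSet[m] (Z ⁻¹' B ∩ E) := (hZ hB).inter hE
      have h1 := setIntegral_condExp (μ := μ) hm
        (f := fun ω => A.indicator (fun _ => (1 : ℝ)) (Y ω))
        (((integrable_const (1 : ℝ)).indicator (hY hA) :
          Integrable ((Y ⁻¹' A).indicator fun _ => (1 : ℝ)) μ)) hEB
      rw [setIntegral_congr_ae (hm _ hEB) ((hmarkov A hA).mono fun ω h _ => h)] at h1
      rw [integral_toReal] at h1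
      · have h2 : ∫ ω in Z ⁻¹' B ∩ E, A.indicator (fun _ => (1 : ℝ)) (Y ω) ∂μ
            = ((μ.restrict E) ((fun ω => (Z ω, Y ω)) ⁻¹' (B ×ˢ A))).toReal := by
          change ∫ ω in Z ⁻¹' B ∩ E, (Y ⁻¹' A).indicator (fun _ => (1 : ℝ)) ω ∂μ = _
          rw [integral_indicator_const _ (hY hA), Measure.restrict_apply (hZY (hB.prod hA))]
          simp only [smul_eq_mul, mul_one, Measure.real]
          rw [Measure.restrict_apply (hY hA)]
          congr 2
          ext ω; simp; tauto
        rw [h2] at h1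
        symm
        refine (ENNReal.toReal_eq_toReal_iff' ?_ ?_).mp h1
        · refine ne_top_of_le_ne_top (b := ∫⁻ ω in Z ⁻¹' B ∩ E, 1 ∂μ) ?_
            (lintegral_mono fun ω => ?_)
          · simp
          · have := hPprob (Z ω).1 (Z ω).2; exact prob_le_one
        · exact measure_ne_top _ _
      · exact ((Kernel.measurable_coe κ hA).comp hZ').aemeasurable
      · exact ae_of_all _ fun ω => by
          have := hPprob (Z ω).1 (Z ω).2; exact measure_lt_top _ _
    have : IsFiniteMeasure ((μ.restrict E).map Z) := by infer_instance
    have h3 : ∫ ω in E, f (Z ω, Y ω) ∂μ = ∫ ω in E, ∫ y, f (Z ω, y) ∂(κ (Z ω)) ∂μ := by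
      rw [← integral_map (μ := μ.restrict E) hZY.aemeasurable hf.aestronglyMeasurable, key,
        Measure.integral_compProd, integral_map hZ'.aemeasurable hK.aestronglyMeasurable]
      exact Integrable.of_bound hf.aestronglyMeasurable G (ae_of_all _ fun q => hG _)
    exact h3.symm
  · exact (hK.comp_measurable hZ).aestronglyMeasurable

theorem mart_aux {Ω : Type*} [mΩ : MeasurableSpace Ω] (μ : Measure Ω) [IsProbabilityMeasure μ]
    (F : Filtration ℕ mΩ) (d : ℕ → Ω → ℝ) (hd : ∀ k, Measurable[F (k + 1)] (d k))
    (G : ℝ) (hG : ∀ k ω, |d k ω| ≤ G) (hc : ∀ k, μ[d k | F k] =ᵐ[μ] 0) :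
    ∀ᵐ ω ∂μ, Tendsto (fun n : ℕ => (∑ k ∈ range n, d k ω) / n) atTop (𝓝 0) := by
  let e : ℕ → Ω → ℝ := fun k => ((k : ℝ) + 1)⁻¹ • d k
  have hem : ∀ k, Measurable[F (k + 1)] (e k) := fun k =>
    Measurable.const_smul (hd k) _
  have heb : ∀ k ω, ‖e k ω‖ ≤ ((k : ℝ) + 1)⁻¹ * G := by
    intro k ω
    simp only [e, Pi.smul_apply, smul_eq_mul, norm_mul]
    rw [Real.norm_of_nonneg (by positivity)]
    exact mul_le_mul_of_nonneg_left (hG k ω) (by positivity)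
  have hei : ∀ k, MemLp (e k) 2 μ := fun k =>
    MemLp.of_bound ((hem k).mono (F.le _) le_rfl).aestronglyMeasurable _ (ae_of_all _ (heb k))
  have hec : ∀ k, μ[e k | F k] =ᵐ[μ] 0 := by
    intro k
    refine (condExp_smul _ _ _).trans ?_
    filter_upwards [hc k] with ω h
    simp [h]
  let M : ℕ → Ω → ℝ := fun n => ∑ k ∈ range n, e k
  have hMm : ∀ n, StronglyMeasurable[F n] (M n) := by
    intro n
    refine Finset.stronglyMeasurable_sum _ fun k hk => ?_
    exact ((hem k).mono (F.mono (by simp at hk; omega)) le_rfl).stronglyMeasurable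
  have hM2 : ∀ n, MemLp (M n) 2 μ := fun n => memLp_finsetSum' _ fun k _ => hei k
  have hMsucc : ∀ n, M (n + 1) = M n + e n := fun n => by simp [M, sum_range_succ]
  have hmart : Martingale M F μ := by
    refine martingale_of_condExp_sub_eq_zero_nat hMm
      (fun n => (hM2 n).integrable one_le_two) fun n => ?_
    rw [hMsucc, add_sub_cancel_left]
    exact hec n
  have horth : ∀ n, ∫ ω, M n ω * e n ω ∂μ = 0 := by
    intro n
    have h1 : Integrable (M n * e n) μ := (hM2 n).integrable_mul (hei n)
    have h2 := condExp_mul_of_stronglyMeasurable_left (m := F n) (hMm n) h1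
      ((hei n).integrable one_le_two)
    change ∫ ω, (M n * e n) ω ∂μ = 0
    rw [← integral_condExp (F.le n), integral_congr_ae h2]
    rw [integral_eq_zero_of_ae]
    filter_upwards [hec n] with ω h
    simp [h]
  have hsq : ∀ n, ∫ ω, M n ω ^ 2 ∂μ ≤ ∑ k ∈ range n, (((k : ℝ) + 1)⁻¹ * G) ^ 2 := by
    intro n
    induction n with
    | zero => simp [M]
    | succ n ih =>
      have h1 : ∫ ω, M (n + 1) ω ^ 2 ∂μ
          = ∫ ω, M n ω ^ 2 ∂μ + 2 * ∫ ω, M n ω * e n ω ∂μ + ∫ ω, e n ω ^ 2 ∂μ := by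
        rw [← integral_const_mul, ← integral_add, ← integral_add]
        · refine integral_congr_ae (ae_of_all _ fun ω => ?_)
          simp only [hMsucc, Pi.add_apply]; ring
        · exact (hM2 n).integrable_sq.add (((hM2 n).integrable_mul (hei n)).const_mul 2)
        · exact (hei n).integrable_sq
        · exact (hM2 n).integrable_sq
        · exact ((hM2 n).integrable_mul (hei n)).const_mul 2
      rw [h1, horth, sum_range_succ, mul_zero, add_zero]
      refine add_le_add ih ?_
      refine (integral_mono (hei n).integrable_sq (integrable_const ((((n : ℝ) + 1)⁻¹ * G) ^ 2))
        fun ω => ?_).trans (by simp)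
      have := heb n ω
      rw [Real.norm_eq_abs] at this
      exact sq_le_sq' (by have := (abs_le.mp this).1; linarith) (abs_le.mp this).2
  have hsumm : Summable fun k : ℕ => (((k : ℝ) + 1)⁻¹ * G) ^ 2 := by
    have h1 : Summable fun k : ℕ => (((k + 1 : ℕ) : ℝ) ^ 2)⁻¹ :=
      (summable_nat_add_iff 1).mpr (Real.summable_nat_pow_inv.mpr one_lt_two)
    refine (h1.mul_right (G ^ 2)).congr fun k => ?_
    push_cast; rw [mul_pow, inv_pow]
  set R := ∑' k : ℕ, (((k : ℝ) + 1)⁻¹ * G) ^ 2 with hR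
  have hbdd : ∀ n, eLpNorm (M n) 1 μ ≤ ((1 + R).toNNReal : ℝ≥0) := by
    intro n
    have hi := (hM2 n).integrable one_le_two
    rw [eLpNorm_one_eq_lintegral_enorm, ← ofReal_integral_norm_eq_lintegral_enorm hi]
    refine ENNReal.ofReal_le_ofReal ?_
    have h1 : ∫ ω, ‖M n ω‖ ∂μ ≤ ∫ ω, (1 + M n ω ^ 2) ∂μ := by
      refine integral_mono hi.norm ((integrable_const _).add (hM2 n).integrable_sq) fun ω => ?_
      simp only [Real.norm_eq_abs]
      nlinarith [sq_abs (M n ω), sq_nonneg (|M n ω| - 1), abs_nonneg (M n ω)]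
    rw [integral_add (integrable_const _) (hM2 n).integrable_sq] at h1
    have h2 := (hsq n).trans (hsumm.sum_le_tsum (range n) fun k _ => by positivity)
    simp only [integral_const, probReal_univ, one_smul] at h1
    linarith
  filter_upwards [hmart.submartingale.exists_ae_tendsto_of_bdd hbdd] with ω ⟨c, hω⟩
  refine kronecker_aux (L := c) ?_
  refine hω.congr fun n => ?_
  simp only [M, Finset.sum_apply, e, Pi.smul_apply, smul_eq_mul, div_eq_inv_mul]

/-- Under (A1), (A2), and either `Σ_k ℙ(C_k)/k < ∞` or
`Σ_j E[τ_j^{-1}] < ∞` (with `τ_j^{-1} = 0` when `τ_j = ∞`), the strong law of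
large numbers holds for any bounded measurable `φ`:
`(1/n) Σ_{k=1}^n φ(X_k) → π(φ)` almost surely. -/
theorem stmt16 {S X : Type*} [MeasurableSpace S] [MeasurableSpace X]
    (P : S → X → Measure X) (π : Measure X) [IsProbabilityMeasure π]
    (hPprob : ∀ s x, IsProbabilityMeasure (P s x))
    (hPmeas : ∀ A : Set X, MeasurableSet A → Measurable fun p : S × X => P p.1 p.2 A)
    (hinv : ∀ s, π.bind (P s) = π)
    (C ρ : ℝ) (hρ : ρ ∈ Set.Ico (0 : ℝ) 1)
    (hA2 : ∀ s x k, tvDist (iterK P s k x) π ≤ C * ρ ^ k)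
    {Ω : Type*} [mΩ : MeasurableSpace Ω] (μ : Measure Ω) [IsProbabilityMeasure μ]
    (F : Filtration ℕ mΩ) (Sp : ℕ → Ω → S) (Xp : ℕ → Ω → X)
    (hadapted : ∀ k, Measurable[F k] fun ω => (Sp k ω, Xp k ω))
    (hmarkov : ∀ (k : ℕ) (A : Set X), MeasurableSet A →
      μ[fun ω => A.indicator (fun _ => (1 : ℝ)) (Xp (k + 1) ω) | F k]
        =ᵐ[μ] fun ω => (P (Sp k ω) (Xp k ω) A).toReal)
    (h : (∑' k : ℕ, μ {ω | Sp (k + 1) ω ≠ Sp k ω} / ((k : ℝ≥0∞) + 1)) ≠ ∞ ∨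
         (∑' j : ℕ, ∫⁻ ω, ((tau Sp (j + 1) ω : ℝ≥0∞))⁻¹ ∂μ) ≠ ∞)
    (φ : X → ℝ) (hφm : Measurable φ) (hφb : ∃ B, ∀ x, |φ x| ≤ B) :
    ∀ᵐ ω ∂μ, Tendsto (fun n : ℕ => (∑ k ∈ Finset.Icc 1 n, φ (Xp k ω)) / n)
      atTop (𝓝 (∫ x, φ x ∂π)) := by
  have hPm : Measurable fun p : S × X => P p.1 p.2 :=
    Measure.measurable_of_measurable_coe _ hPmeas
  obtain ⟨g, G, hgm, hgb, hpois⟩ := poisson_aux P π hPprob hPm C ρ hρ hA2 φ hφm hφb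
  obtain ⟨B, hB⟩ := hφb
  set c := ∫ x, φ x ∂π with hc
  have hZm : ∀ k, Measurable fun ω => (Sp k ω, Xp k ω) := fun k =>
    (hadapted k).mono (F.le k) le_rfl
  have hSF : ∀ k, Measurable[F k] (Sp k) := fun k => measurable_fst.comp (hadapted k)
  have hXF : ∀ k, Measurable[F k] (Xp k) := fun k => measurable_snd.comp (hadapted k)
  have hSm : ∀ k, Measurable (Sp k) := fun k => measurable_fst.comp (hZm k)
  have hXm : ∀ k, Measurable (Xp k) := fun k => measurable_snd.comp (hZm k)
  -- the jump sets
  let D : ℕ → Set Ω := fun k => {ω | g (Sp (k + 1) ω, Xp (k + 1) ω) ≠ g (Sp k ω, Xp (k + 1) ω)}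
  have hDm : ∀ k, MeasurableSet (D k) := fun k =>
    (measurableSet_eq_fun (hgm.comp (hZm (k + 1)))
      (hgm.comp ((hSm k).prodMk (hXm (k + 1))))).compl
  have hD : ∀ k, ∀ ω ∈ D k, Sp (k + 1) ω ≠ Sp k ω := by
    intro k ω hω heq
    exact hω (by rw [heq])
  have hjump := summable_aux μ Sp D hDm hD h
  -- the martingale differences
  let d : ℕ → Ω → ℝ := fun k ω =>
    g (Sp k ω, Xp (k + 1) ω) - (g (Sp k ω, Xp k ω) - (φ (Xp k ω) - c))
  have hgk : ∀ k, Measurable[F k] fun ω => g (Sp k ω, Xp k ω) - (φ (Xp k ω) - c) := fun k =>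
    (hgm.comp (hadapted k)).sub ((hφm.comp (hXF k)).sub measurable_const)
  have hgk1 : ∀ k, Measurable[F (k + 1)] fun ω => g (Sp k ω, Xp (k + 1) ω) := fun k =>
    hgm.comp (((hSF k).mono (F.mono (Nat.le_succ k)) le_rfl).prodMk (hXF (k + 1)))
  have hdm : ∀ k, Measurable[F (k + 1)] (d k) := fun k =>
    (hgk1 k).sub ((hgk k).mono (F.mono (Nat.le_succ k)) le_rfl)
  have hdb : ∀ k ω, |d k ω| ≤ G + (G + (B + |c|)) := by
    intro k ω
    refine (abs_sub _ _).trans (add_le_add (hgb _) ((abs_sub _ _).trans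
      (add_le_add (hgb _) ((abs_sub _ _).trans (add_le_add (hB _) le_rfl)))))
  have hdc : ∀ k, μ[d k | F k] =ᵐ[μ] 0 := by
    intro k
    have h1 := condExp_aux P hPprob hPm (F k) μ (F.le k) (fun ω => (Sp k ω, Xp k ω)) (Xp (k + 1))
      (hadapted k) (hXm (k + 1)) (hmarkov k) g hgm G hgb
    have hi1 : Integrable (fun ω => g (Sp k ω, Xp (k + 1) ω)) μ :=
      Integrable.of_bound ((hgk1 k).mono (F.le _) le_rfl).aestronglyMeasurable G
        (ae_of_all _ fun ω => hgb _)
    have hi2 : Integrable (fun ω => g (Sp k ω, Xp k ω) - (φ (Xp k ω) - c)) μ :=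
      Integrable.of_bound ((hgk k).mono (F.le _) le_rfl).aestronglyMeasurable (G + (B + |c|))
        (ae_of_all _ fun ω => (abs_sub _ _).trans
          (add_le_add (hgb _) ((abs_sub _ _).trans (add_le_add (hB _) le_rfl))))
    have h2 := condExp_sub hi1 hi2 (F k)
    refine EventuallyEq.trans h2 ?_
    rw [condExp_of_stronglyMeasurable (F.le k) (hgk k).stronglyMeasurable hi2]
    filter_upwards [h1] with ω hω
    simp only [Pi.sub_apply, Pi.zero_apply]
    rw [hω, hpois (Sp k ω) (Xp k ω)]
    ring
  have hmart := mart_aux μ F d hdm _ hdb hdc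
  filter_upwards [hjump, hmart] with ω hj hm
  -- the jump terms
  let J : ℕ → ℝ := fun k => g (Sp (k + 1) ω, Xp (k + 1) ω) - g (Sp k ω, Xp (k + 1) ω)
  have hJ : Tendsto (fun n : ℕ => (∑ k ∈ range n, J k) / n) atTop (𝓝 0) := by
    have hs := ENNReal.summable_toReal hj.ne
    have hs2 : Summable fun k : ℕ => J k / ((k : ℝ) + 1) := by
      refine Summable.of_norm_bounded (hs.mul_left (G + G)) fun k => ?_
      by_cases hk : ω ∈ D k
      · rw [Set.indicator_of_mem hk, ENNReal.toReal_inv, norm_div, div_eq_mul_inv]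
        have h1 : (((k : ℝ≥0∞) + 1)).toReal = (k : ℝ) + 1 := by
          rw [ENNReal.toReal_add (by simp) (by simp)]; simp
        rw [h1, Real.norm_of_nonneg (by positivity : (0 : ℝ) ≤ (k : ℝ) + 1)]
        exact mul_le_mul_of_nonneg_right
          ((abs_sub _ _).trans (add_le_add (hgb _) (hgb _))) (by positivity)
      · have h1 : J k = 0 := by
          simp only [D, Set.mem_setOf_eq, not_not] at hk
          simp only [J, hk, sub_self]
        rw [h1, Set.indicator_of_notMem hk]; simp
    exact kronecker_aux hs2.hasSum.tendsto_sum_nat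
  -- the decomposition
  have hdec : ∀ n : ℕ, ∑ k ∈ Finset.Icc 1 n, φ (Xp k ω) = n * c + ∑ k ∈ range n, d k ω
      + ∑ k ∈ range n, J k
      + (g (Sp 0 ω, Xp 0 ω) - φ (Xp 0 ω) - (g (Sp n ω, Xp n ω) - φ (Xp n ω))) := by
    intro n
    induction n with
    | zero => simp
    | succ n ih =>
      rw [Finset.sum_Icc_succ_top (by omega), ih, sum_range_succ, sum_range_succ]
      simp only [d, J]
      push_cast
      ring
  have hrem : Tendsto (fun n : ℕ =>
      (g (Sp 0 ω, Xp 0 ω) - φ (Xp 0 ω) - (g (Sp n ω, Xp n ω) - φ (Xp n ω))) / (n : ℝ))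
      atTop (𝓝 0) := by
    refine squeeze_zero_norm (a := fun n : ℕ => ((G + B) + (G + B)) / (n : ℝ)) (fun n => ?_)
      (tendsto_const_div_atTop_nhds_zero_nat _)
    rw [norm_div, Real.norm_of_nonneg (Nat.cast_nonneg n)]
    refine div_le_div_of_nonneg_right ?_ (Nat.cast_nonneg n)
    exact (abs_sub _ _).trans (add_le_add ((abs_sub _ _).trans (add_le_add (hgb _) (hB _)))
      ((abs_sub _ _).trans (add_le_add (hgb _) (hB _))))
  have hfin := ((tendsto_const_nhds (x := c)).add hm).add (hJ.add hrem)
  simp only [add_zero] at hfin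
  refine hfin.congr' ?_
  filter_upwards [eventually_gt_atTop 0] with n hn
  have hn' : (n : ℝ) ≠ 0 := by positivity
  rw [hdec]
  field_simp
  ring
end

section
/- Assume the uniform Dobrushin–Doeblin condition (A8) with constant β < 1, let (s_k)_{k≥0} be a deterministic sequence in S, let φ: X → ℝ be bounded measurable, and let (X_k)_{k≥0} satisfy (A1) with S_k = s_k, i.e., ℙ(X_{k+1} ∈ A | F_k) = P_{s_k}(X_k, A) a.s. for all k and A ∈ 𝒳. Then A_n/n → 0 in probability as n → ∞, where A_n = Σ_{k=1}^n [g_{s_k}(X_k) − g_{s_{k−1}}(X_k)], and consequently the weak law of large numbers holds: (1/n) Σ_{k=1}^n φ(X_k) → π(φ) in probability. -/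
open MeasureTheory Filter Finset ProbabilityTheory
open scoped ENNReal NNReal Topology

lemma aux_integrable {X : Type*} [MeasurableSpace X] (m : Measure X) [IsFiniteMeasure m]
    {f : X → ℝ} (hf : Measurable f) {C : ℝ} (hC : ∀ x, |f x| ≤ C) : Integrable f m :=
  Integrable.of_bound hf.aestronglyMeasurable C (ae_of_all _ hC)

lemma aux_abs_integral_le {X : Type*} [MeasurableSpace X] (m : Measure X)
    [IsProbabilityMeasure m] {f : X → ℝ} {C : ℝ} (hC : ∀ x, |f x| ≤ C) :
    |∫ x, f x ∂m| ≤ C := by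
  have := norm_integral_le_of_norm_le_const (μ := m) (f := f) (C := C) (ae_of_all _ hC)
  simpa using this

lemma aux_integral_bind {X Y : Type*} [MeasurableSpace X] [MeasurableSpace Y] (m : Measure X)
    [IsFiniteMeasure m] (κ : X → Measure Y) (hκ : Measurable κ)
    (hp : ∀ x, IsProbabilityMeasure (κ x))
    {f : Y → ℝ} (hf : Measurable f) {C : ℝ} (hC : ∀ x, |f x| ≤ C) :
    ∫ y, f y ∂(m.bind κ) = ∫ x, ∫ y, f y ∂(κ x) ∂m := by
  let K : Kernel X Y := ⟨κ, hκ⟩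
  have : IsMarkovKernel K := ⟨hp⟩
  have h1 : m.bind κ = (K ∘ₖ Kernel.const Unit m) () := by
    rw [← Measure.comp_eq_comp_const_apply]; rfl
  rw [h1, Kernel.integral_comp]
  · simp [K]
  · exact aux_integrable _ hf hC

lemma aux_measurable_integral {X Y : Type*} [MeasurableSpace X] [MeasurableSpace Y]
    (κ : X → Measure Y) (hκ : Measurable κ)
    (hp : ∀ x, IsProbabilityMeasure (κ x))
    {f : Y → ℝ} (hf : Measurable f) :
    Measurable fun x => ∫ y, f y ∂(κ x) := by
  let K : Kernel X Y := ⟨κ, hκ⟩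
  have : IsMarkovKernel K := ⟨hp⟩
  have := (hf.stronglyMeasurable.integral_kernel (κ := K)).measurable
  exact this

lemma aux_tv {X : Type*} [MeasurableSpace X] (m n : Measure X) [IsProbabilityMeasure m]
    [IsProbabilityMeasure n] {β : ℝ} (h : tvDist m n ≤ β) {A : Set X} (hA : MeasurableSet A) :
    |m.real A - n.real A| ≤ β := by
  refine le_trans ?_ h
  unfold tvDist
  refine le_ciSup (f := fun A : {A : Set X // MeasurableSet A} =>
    |(m A.1).toReal - (n A.1).toReal|) ?_ ⟨A, hA⟩
  refine ⟨1, ?_⟩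
  rintro _ ⟨B, rfl⟩
  have h1 : m.real B.1 ≤ 1 := measureReal_le_one
  have h2 : n.real B.1 ≤ 1 := measureReal_le_one
  have h3 : 0 ≤ m.real B.1 := measureReal_nonneg
  have h4 : 0 ≤ n.real B.1 := measureReal_nonneg
  simp only [← measureReal_def]
  rw [abs_le]; constructor <;> linarith

lemma aux_dob_nonneg {X : Type*} [MeasurableSpace X] (m n : Measure X) [IsProbabilityMeasure m]
    [IsProbabilityMeasure n] {β : ℝ} (h : tvDist m n ≤ β) {f : X → ℝ} (hf : Measurable f)
    {D : ℝ} (hD : 0 ≤ D) (h0 : ∀ x, 0 ≤ f x) (h1 : ∀ x, f x ≤ D) :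
    |∫ x, f x ∂m - ∫ x, f x ∂n| ≤ β * D := by
  have hb : ∀ x, |f x| ≤ D := fun x => by rw [abs_of_nonneg (h0 x)]; exact h1 x
  have key : ∀ (q : Measure X) [IsProbabilityMeasure q],
      IntegrableOn (fun t => q.real {a | t ≤ f a}) (Set.Ioc 0 D) := by
    intro q _
    have hanti : Antitone (fun t => q.real {a | t ≤ f a}) := by
      intro s t hst
      exact measureReal_mono (fun a (ha : t ≤ f a) => hst.trans ha)
    refine Integrable.of_bound hanti.measurable.aestronglyMeasurable 1 (ae_of_all _ fun t => ?_)
    rw [Real.norm_of_nonneg measureReal_nonneg]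
    exact measureReal_le_one
  rw [(aux_integrable m hf hb).integral_eq_integral_Ioc_meas_le (ae_of_all _ h0) (ae_of_all _ h1),
    (aux_integrable n hf hb).integral_eq_integral_Ioc_meas_le (ae_of_all _ h0) (ae_of_all _ h1),
    ← integral_sub (key m) (key n)]
  have := norm_setIntegral_le_of_norm_le_const (μ := volume) (s := Set.Ioc 0 D) (C := β)
    (f := fun t => m.real {a | t ≤ f a} - n.real {a | t ≤ f a}) (by simp)
    (fun t _ => aux_tv m n h (measurableSet_le measurable_const hf))
  simpa [hD] using this

lemma aux_dob {X : Type*} [MeasurableSpace X] (m n : Measure X) [IsProbabilityMeasure m]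
    [IsProbabilityMeasure n] {β : ℝ} (h : tvDist m n ≤ β) {f : X → ℝ} (hf : Measurable f)
    {C D : ℝ} (hD : 0 ≤ D) (hC : ∀ x, |f x| ≤ C) (h1 : ∀ x y, |f x - f y| ≤ D) :
    |∫ x, f x ∂m - ∫ x, f x ∂n| ≤ β * D := by
  have : Nonempty X := Measure.nonempty_of_neZero m
  have hbdd : BddBelow (Set.range f) := ⟨-C, by
    rintro _ ⟨x, rfl⟩; exact (abs_le.1 (hC x)).1⟩
  have := aux_dob_nonneg m n h (f := fun x => f x - ⨅ y, f y) (hf.sub_const _) hD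
    (fun x => sub_nonneg.2 (ciInf_le hbdd x)) (fun x => by
      have : f x - D ≤ ⨅ y, f y := le_ciInf fun y => by
        have := (abs_le.1 (h1 x y)).2; linarith
      linarith)
  rw [integral_sub (aux_integrable m hf hC) (integrable_const _),
    integral_sub (aux_integrable n hf hC) (integrable_const _)] at this
  simpa using this

/-- mean zero with oscillation at most `D`, measurable. -/
structure Good {X : Type*} [MeasurableSpace X] (π : Measure X) (D : ℝ) (f : X → ℝ) : Prop where
  meas : Measurable f
  osc : ∀ x y, |f x - f y| ≤ D
  bd : ∀ x, |f x| ≤ D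
  mean : ∫ x, f x ∂π = 0

lemma aux_bd {X : Type*} [MeasurableSpace X] (π : Measure X) [IsProbabilityMeasure π]
    {f : X → ℝ} {C D : ℝ} (hf : Measurable f) (hC : ∀ x, |f x| ≤ C)
    (h1 : ∀ x y, |f x - f y| ≤ D) (h0 : ∫ x, f x ∂π = 0) : Good π D f := by
  refine ⟨hf, h1, fun x => ?_, h0⟩
  have := aux_abs_integral_le π (h1 x)
  rw [integral_sub (integrable_const _) (aux_integrable π hf hC), h0] at this
  simpa using this

lemma Good.step {X : Type*} [MeasurableSpace X] {π : Measure X} [IsProbabilityMeasure π]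
    {κ : X → Measure X} (hκ : Measurable κ) (hp : ∀ x, IsProbabilityMeasure (κ x))
    (hinv : π.bind κ = π) {β : ℝ} (hA : ∀ x y, tvDist (κ x) (κ y) ≤ β) {D : ℝ} {f : X → ℝ}
    (hf : Good π D f) : Good π (β * D) (fun x => ∫ y, f y ∂(κ x)) := by
  have : Nonempty X := Measure.nonempty_of_neZero π
  have hD : 0 ≤ D := (abs_nonneg _).trans (hf.bd (Classical.arbitrary X))
  refine aux_bd π (C := D) (aux_measurable_integral κ hκ hp hf.meas) (fun x => ?_)
    (fun x y => ?_) ?_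
  · exact aux_abs_integral_le (κ x) hf.bd
  · exact aux_dob _ _ (hA x y) hf.meas hD hf.bd hf.osc
  · rw [← aux_integral_bind π κ hκ hp hf.meas hf.bd, hinv, hf.mean]

section
variable {S X : Type*} [MeasurableSpace X] (P : S → X → Measure X) (s : S)

lemma aux_iterK (hκ : Measurable (P s)) (hp : ∀ x, IsProbabilityMeasure (P s x)) (k : ℕ) :
    Measurable (iterK P s k) ∧ ∀ x, IsProbabilityMeasure (iterK P s k x) := by
  induction k with
  | zero =>
    refine ⟨Measure.measurable_dirac, fun x => ?_⟩
    exact Measure.dirac.isProbabilityMeasure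
  | succ k ih =>
    refine ⟨(Measure.measurable_bind' ih.1).comp hκ, fun x => ?_⟩
    have := hp x
    refine ⟨?_⟩
    change ((P s x).bind (iterK P s k)) Set.univ = 1
    rw [Measure.bind_apply MeasurableSet.univ ih.1.aemeasurable]
    have : ∀ y, iterK P s k y Set.univ = 1 := fun y => (ih.2 y).measure_univ
    simp [this]

lemma aux_iter_good {π : Measure X} [IsProbabilityMeasure π]
    (hκ : Measurable (P s)) (hp : ∀ x, IsProbabilityMeasure (P s x))
    (hinv : π.bind (P s) = π) {β : ℝ} (hA : ∀ x y, tvDist (P s x) (P s y) ≤ β) {D : ℝ}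
    {f : X → ℝ} (hf : Good π D f) (k : ℕ) :
    Good π (β ^ k * D) (fun x => ∫ y, f y ∂(iterK P s k x)) := by
  induction k with
  | zero =>
    have : (fun x => ∫ y, f y ∂(iterK P s 0 x)) = f := by
      funext x
      exact integral_dirac' f x hf.meas.stronglyMeasurable
    rw [this]; simpa using hf
  | succ k ih =>
    have : (fun x => ∫ y, f y ∂(iterK P s (k+1) x)) =
        fun x => ∫ z, (fun z => ∫ y, f y ∂(iterK P s k z)) z ∂(P s x) := by
      funext x
      exact aux_integral_bind (P s x) (iterK P s k) (aux_iterK P s hκ hp k).1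
        (aux_iterK P s hκ hp k).2 hf.meas hf.bd
    rw [this, pow_succ', mul_assoc]
    exact ih.step hκ hp hinv hA

lemma aux_gfun {π : Measure X} [IsProbabilityMeasure π]
    (hκ : Measurable (P s)) (hp : ∀ x, IsProbabilityMeasure (P s x))
    (hinv : π.bind (P s) = π) {β : ℝ} (hβ0 : 0 ≤ β) (hβ : β < 1)
    (hA : ∀ x y, tvDist (P s x) (P s y) ≤ β) {D : ℝ}
    {φ : X → ℝ} (hf : Good π D (fun y => φ y - ∫ z, φ z ∂π)) :
    Measurable (gfun P π φ s) ∧ (∀ x, |gfun P π φ s x| ≤ D * (1 - β)⁻¹) ∧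
      ∫ x, gfun P π φ s x ∂π = 0 := by
  have hg := aux_iter_good P s hκ hp hinv hA hf
  have hs : HasSum (fun k => β ^ k * D) (D * (1 - β)⁻¹) := by
    rw [mul_comm]; exact (hasSum_geometric_of_lt_one hβ0 hβ).mul_right D
  have hsum : ∀ x, Summable fun k => ∫ y, (φ y - ∫ z, φ z ∂π) ∂(iterK P s k x) := fun x =>
    Summable.of_norm_bounded hs.summable (fun k => (hg k).bd x)
  refine ⟨?_, fun x => ?_, ?_⟩
  · refine measurable_of_tendsto_metrizable
      (f := fun n x => ∑ k ∈ Finset.range n, ∫ y, (φ y - ∫ z, φ z ∂π) ∂(iterK P s k x)) ?_ ?_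
    · intro n
      exact Finset.measurable_fun_sum _ fun k _ => (hg k).meas
    · exact tendsto_pi_nhds.2 fun x => (hsum x).hasSum.tendsto_sum_nat
  · exact tsum_of_norm_bounded
      (f := fun k => ∫ y, (φ y - ∫ z, φ z ∂π) ∂(iterK P s k x)) hs (fun k => (hg k).bd x)
  · have := hasSum_integral_of_summable_integral_norm (μ := π)
      (F := fun k x => ∫ y, (φ y - ∫ z, φ z ∂π) ∂(iterK P s k x))
      (fun k => aux_integrable π (hg k).meas (hg k).bd) (by
        refine Summable.of_norm_bounded hs.summable (fun k => ?_)
        exact aux_abs_integral_le π (fun x => by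
          rw [Real.norm_eq_abs, abs_abs]; exact (hg k).bd x))
    have h0 : (fun k => ∫ x, (∫ y, (φ y - ∫ z, φ z ∂π) ∂(iterK P s k x)) ∂π) = fun _ => 0 := by
      funext k; exact (hg k).mean
    rw [h0] at this
    exact this.unique hasSum_zero

end

lemma aux_markov {X : Type*} [MeasurableSpace X] {κ : X → Measure X} (hκ : Measurable κ)
    (hp : ∀ x, IsProbabilityMeasure (κ x))
    {Ω : Type*} {m : MeasurableSpace Ω} [mΩ : MeasurableSpace Ω] (μ : Measure Ω)
    [IsProbabilityMeasure μ] (hm : m ≤ mΩ) {Y Z : Ω → X} (hY : Measurable[m] Y)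
    (hZ : Measurable Z)
    (hmarkov : ∀ A : Set X, MeasurableSet A →
      μ[fun ω => A.indicator (fun _ => (1 : ℝ)) (Z ω) | m] =ᵐ[μ] fun ω => (κ (Y ω) A).toReal)
    {f : X → ℝ} (hf : Measurable f) {C : ℝ} (hC : ∀ x, |f x| ≤ C)
    {T : Ω → ℝ} (hT : Measurable[m] T) {K : ℝ} (hK : ∀ ω, |T ω| ≤ K) :
    ∫ ω, T ω * f (Z ω) ∂μ = ∫ ω, T ω * (∫ y, f y ∂(κ (Y ω))) ∂μ := by
  have hY' : Measurable Y := hY.mono hm le_rfl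
  have hPf : Measurable fun x => ∫ y, f y ∂(κ x) := aux_measurable_integral κ hκ hp hf
  have hPb : ∀ x, |∫ y, f y ∂(κ x)| ≤ C := fun x => aux_abs_integral_le (κ x) hC
  have hfZ : Integrable (fun ω => f (Z ω)) μ :=
    aux_integrable μ (hf.comp hZ) (fun ω => hC _)
  have hgY : Integrable (fun ω => ∫ y, f y ∂(κ (Y ω))) μ :=
    aux_integrable μ (hPf.comp hY') (fun ω => hPb _)
  have hce : (fun ω => ∫ y, f y ∂(κ (Y ω))) =ᵐ[μ] μ[fun ω => f (Z ω) | m] := by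
    refine ae_eq_condExp_of_forall_setIntegral_eq hm hfZ (fun B _ _ => hgY.integrableOn)
      (fun B hB _ => ?_) (hPf.comp hY).stronglyMeasurable.aestronglyMeasurable
    have hmeas : ((μ.restrict B).map Y).bind κ = (μ.restrict B).map Z := by
      ext A hA
      rw [Measure.bind_apply hA hκ.aemeasurable,
        lintegral_map (f := fun a => κ a A) ((Measure.measurable_coe hA).comp hκ) hY', Measure.map_apply hZ hA]
      have hi : Integrable (fun ω => A.indicator (fun _ => (1 : ℝ)) (Z ω)) μ :=
        aux_integrable μ (C := 1) ((measurable_const.indicator hA).comp hZ) (fun ω => by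
          by_cases h : Z ω ∈ A <;> simp [h])
      have h1 := setIntegral_condExp hm hi hB
      rw [setIntegral_congr_ae (g := fun ω => (κ (Y ω) A).toReal) (hm _ hB)
        ((hmarkov A hA).mono fun ω h _ => h)] at h1
      have h2 : ∫ ω in B, A.indicator (fun _ => (1 : ℝ)) (Z ω) ∂μ
          = ((μ.restrict B) (Z ⁻¹' A)).toReal := by
        have : (fun ω => A.indicator (fun _ => (1 : ℝ)) (Z ω))
            = (Z ⁻¹' A).indicator (fun _ => (1 : ℝ)) := rfl
        rw [this, integral_indicator (hZ hA)]
        simp [measureReal_def]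
      rw [h2, integral_toReal] at h1
      · refine (ENNReal.toReal_eq_toReal_iff' ?_ (measure_ne_top _ _)).1 h1
        refine ((lintegral_mono (g := fun _ => (1 : ℝ≥0∞)) fun ω => ?_).trans_lt ?_).ne
        · exact prob_le_one
        · simp
      · exact (((Measure.measurable_coe hA).comp hκ).comp hY').aemeasurable
      · exact ae_of_all _ fun ω => measure_lt_top _ _
    have h3 := aux_integral_bind ((μ.restrict B).map Y) κ hκ hp hf hC
    rw [hmeas, integral_map hZ.aemeasurable hf.aestronglyMeasurable,
      integral_map hY'.aemeasurable hPf.aestronglyMeasurable] at h3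
    exact h3.symm
  have hpull := condExp_stronglyMeasurable_mul_of_bound hm hT.stronglyMeasurable hfZ K
    (ae_of_all μ hK)
  calc ∫ ω, T ω * f (Z ω) ∂μ = ∫ ω, (μ[T * (fun ω => f (Z ω)) | m]) ω ∂μ :=
        (integral_condExp hm).symm
    _ = ∫ ω, T ω * (∫ y, f y ∂(κ (Y ω))) ∂μ := by
        refine integral_congr_ae ?_
        filter_upwards [hpull, hce] with ω h1 h2
        rw [h1, Pi.mul_apply, ← h2]

lemma aux_wlln {X : Type*} [MeasurableSpace X]
    (Q : ℕ → X → Measure X) (π : Measure X) [IsProbabilityMeasure π]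
    (hQ : ∀ k, Measurable (Q k)) (hp : ∀ k x, IsProbabilityMeasure (Q k x))
    (hinv : ∀ k, π.bind (Q k) = π)
    (β : ℝ) (hβ0 : 0 ≤ β) (hβ : β < 1)
    (hA8 : ∀ k x y, tvDist (Q k x) (Q k y) ≤ β)
    {Ω : Type*} [mΩ : MeasurableSpace Ω] (μ : Measure Ω) [IsProbabilityMeasure μ]
    (F : Filtration ℕ mΩ) (Xp : ℕ → Ω → X)
    (hadapted : ∀ k, Measurable[F k] (Xp k))
    (hmarkov : ∀ (k : ℕ) (A : Set X), MeasurableSet A →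
      μ[fun ω => A.indicator (fun _ => (1 : ℝ)) (Xp (k + 1) ω) | F k]
        =ᵐ[μ] fun ω => (Q k (Xp k ω) A).toReal)
    (f : ℕ → X → ℝ) (B : ℝ) (hf : ∀ k, Good π B (f k)) :
    TendstoInMeasure μ (fun n ω => (∑ k ∈ Finset.Icc 1 n, f k (Xp k ω)) / n)
      atTop (fun _ => 0) := by
  have : Nonempty X := Measure.nonempty_of_neZero π
  have hB : 0 ≤ B := (abs_nonneg _).trans ((hf 0).bd (Classical.arbitrary X))
  have hX : ∀ k, Measurable (Xp k) := fun k => (hadapted k).mono (F.le k) le_rfl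
  set T : ℕ → Ω → ℝ := fun n ω => ∑ k ∈ Finset.Icc 1 n, f k (Xp k ω) with hTdef
  have hTm : ∀ n, Measurable[F n] (T n) := fun n => by
    refine Finset.measurable_fun_sum _ fun k hk => (hf k).meas.comp ?_
    exact (hadapted k).mono (F.mono (Finset.mem_Icc.1 hk).2) le_rfl
  have hTm' : ∀ n, Measurable (T n) := fun n => (hTm n).mono (F.le n) le_rfl
  have hTb : ∀ n ω, |T n ω| ≤ n * B := fun n ω => by
    refine (Finset.abs_sum_le_sum_abs _ _).trans ?_
    refine (Finset.sum_le_card_nsmul _ _ B fun k _ => (hf k).bd _).trans ?_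
    simp
  have hTs : ∀ n ω, T (n+1) ω = T n ω + f (n+1) (Xp (n+1) ω) := fun n ω => by
    simp only [hTdef]
    rw [Finset.sum_Icc_succ_top (by omega)]
  -- correlation bound
  have hcorr : ∀ n (D : ℝ) (h : X → ℝ), Good π D h →
      |∫ ω, T n ω * h (Xp n ω) ∂μ| ≤ B * (1 - β)⁻¹ * D ∧
      |∫ ω, T n ω * h (Xp (n+1) ω) ∂μ| ≤ B * (1 - β)⁻¹ * (β * D) := by
    have hstep : ∀ n (D : ℝ) (h : X → ℝ), Good π D h →
        (∀ (D : ℝ) (h : X → ℝ), Good π D h →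
          |∫ ω, T n ω * h (Xp n ω) ∂μ| ≤ B * (1 - β)⁻¹ * D) →
        |∫ ω, T n ω * h (Xp (n+1) ω) ∂μ| ≤ B * (1 - β)⁻¹ * (β * D) := by
      intro n D h hh ih
      rw [aux_markov (hQ n) (hp n) μ (F.le n) (hadapted n) (hX (n+1)) (hmarkov n) hh.meas hh.bd
        (hTm n) (hTb n)]
      exact ih _ _ (hh.step (hQ n) (hp n) (hinv n) (hA8 n))
    have hfirst : ∀ n (D : ℝ) (h : X → ℝ), Good π D h →
        |∫ ω, T n ω * h (Xp n ω) ∂μ| ≤ B * (1 - β)⁻¹ * D := by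
      intro n
      induction n with
      | zero =>
        intro D h hh
        have hD : 0 ≤ D := (abs_nonneg _).trans (hh.bd (Classical.arbitrary X))
        have : 0 < 1 - β := by linarith
        simp only [hTdef]
        simp
        positivity
      | succ n ih =>
        intro D h hh
        have hD : 0 ≤ D := (abs_nonneg _).trans (hh.bd (Classical.arbitrary X))
        have h1 := hstep n D h hh ih
        have hpos : 0 < 1 - β := by linarith
        have hb2 : ∀ ω, |f (n+1) (Xp (n+1) ω) * h (Xp (n+1) ω)| ≤ B * D := fun ω => by
          rw [abs_mul]
          exact mul_le_mul ((hf _).bd _) (hh.bd _) (abs_nonneg _) hB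
        have h2 := aux_abs_integral_le μ hb2
        have heq : ∫ ω, T (n+1) ω * h (Xp (n+1) ω) ∂μ = ∫ ω, T n ω * h (Xp (n+1) ω) ∂μ
            + ∫ ω, f (n+1) (Xp (n+1) ω) * h (Xp (n+1) ω) ∂μ := by
          rw [← integral_add]
          · simp only [hTs, add_mul]
          · refine aux_integrable μ (C := n * B * D) ((hTm' n).mul (hh.meas.comp (hX _))) ?_
            intro ω
            rw [abs_mul]
            exact mul_le_mul (hTb n ω) (hh.bd _) (abs_nonneg _) (by positivity)
          · exact aux_integrable μ (((hf _).meas.comp (hX _)).mul (hh.meas.comp (hX _))) hb2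
        rw [heq]
        refine (abs_add_le _ _).trans ((add_le_add h1 h2).trans (le_of_eq ?_))
        field_simp
        ring
    exact fun n D h hh => ⟨hfirst n D h hh, hstep n D h hh (hfirst n)⟩
  set C : ℝ := 2 * (B * (1 - β)⁻¹ * (β * B)) + B * B with hC
  have hsqi : ∀ n, Integrable (fun ω => T n ω ^ 2) μ := fun n =>
    aux_integrable μ (C := (n * B) ^ 2) ((hTm' n).pow_const 2) fun ω => by
      rw [abs_pow]; exact pow_le_pow_left₀ (abs_nonneg _) (hTb n ω) 2
  have hvar : ∀ n : ℕ, ∫ ω, T n ω ^ 2 ∂μ ≤ n * C := by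
    intro n
    induction n with
    | zero => simp [hTdef]
    | succ n ih =>
      have hb2 : ∀ ω, |f (n+1) (Xp (n+1) ω) * f (n+1) (Xp (n+1) ω)| ≤ B * B := fun ω => by
        rw [abs_mul]
        exact mul_le_mul ((hf _).bd _) ((hf _).bd _) (abs_nonneg _) hB
      have hi2 : Integrable (fun ω => f (n+1) (Xp (n+1) ω) * f (n+1) (Xp (n+1) ω)) μ :=
        aux_integrable μ (((hf _).meas.comp (hX _)).mul ((hf _).meas.comp (hX _))) hb2
      have hi1 : Integrable (fun ω => T n ω * f (n+1) (Xp (n+1) ω)) μ := by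
        refine aux_integrable μ (C := n * B * B) ((hTm' n).mul ((hf _).meas.comp (hX _))) ?_
        intro ω
        rw [abs_mul]
        exact mul_le_mul (hTb n ω) ((hf _).bd _) (abs_nonneg _) (by positivity)
      have heq : ∫ ω, T (n+1) ω ^ 2 ∂μ = ∫ ω, T n ω ^ 2 ∂μ
          + 2 * ∫ ω, T n ω * f (n+1) (Xp (n+1) ω) ∂μ
          + ∫ ω, f (n+1) (Xp (n+1) ω) * f (n+1) (Xp (n+1) ω) ∂μ := by
        rw [← integral_const_mul, ← integral_add (hsqi n) (hi1.const_mul 2),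
          ← integral_add (f := fun ω => T n ω ^ 2 + 2 * (T n ω * f (n+1) (Xp (n+1) ω)))
            ((hsqi n).add (hi1.const_mul 2)) hi2]
        refine integral_congr_ae (ae_of_all _ fun ω => ?_)
        simp only [hTs]
        ring
      have h1 := (abs_le.1 (hcorr n B _ (hf (n+1))).2).2
      have h2 := (abs_le.1 (aux_abs_integral_le μ hb2)).2
      rw [heq]
      push_cast
      rw [hC] at ih ⊢
      linarith
  rw [tendstoInMeasure_iff_norm]
  intro ε hε
  have hlim : Tendsto (fun n : ℕ => ENNReal.ofReal (C / ε ^ 2 / n)) atTop (𝓝 0) := by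
    have := ENNReal.tendsto_ofReal (tendsto_const_div_atTop_nhds_zero_nat (C / ε ^ 2))
    simpa using this
  refine tendsto_of_tendsto_of_tendsto_of_le_of_le' tendsto_const_nhds hlim
    (Eventually.of_forall fun _ => zero_le) ?_
  filter_upwards [eventually_gt_atTop 0] with n hn
  have hn' : (0 : ℝ) < n := by exact_mod_cast hn
  have hch := mul_meas_ge_le_integral_of_nonneg (μ := μ) (f := fun ω => T n ω ^ 2)
    (ae_of_all _ fun ω => sq_nonneg _) (hsqi n) ((ε * n) ^ 2)
  have hset : {ω | ε ≤ ‖T n ω / n - 0‖} = {ω | (ε * n) ^ 2 ≤ T n ω ^ 2} := by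
    ext ω
    simp only [Set.mem_ofPred_eq, sub_zero, Real.norm_eq_abs, abs_div, Nat.abs_cast]
    rw [le_div_iff₀ hn', sq_le_sq, abs_of_pos (mul_pos hε hn')]
  rw [hset, ← ofReal_measureReal]
  refine ENNReal.ofReal_le_ofReal ?_
  rw [div_div, le_div_iff₀ (by positivity)]
  have := hch.trans (hvar n)
  have h4 : n * (μ.real {ω | (ε * n) ^ 2 ≤ T n ω ^ 2} * (ε ^ 2 * n)) ≤ n * C := by
    calc _ = _ := by ring
      _ ≤ _ := this
  exact le_of_mul_le_mul_left h4 hn'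

/-- Under the uniform Dobrushin–Doeblin condition (A8) with
`β < 1`, for a deterministic parameter sequence `(s_k)` and a chain satisfying
(A1) with `S_k = s_k`, the adaptation term satisfies `A_n/n → 0` in
probability, and consequently the weak law of large numbers holds. -/
theorem stmt17 {S X : Type*} [MeasurableSpace S] [MeasurableSpace X]
    (P : S → X → Measure X) (π : Measure X) [IsProbabilityMeasure π]
    (hPprob : ∀ s x, IsProbabilityMeasure (P s x))
    (hPmeas : ∀ A : Set X, MeasurableSet A → Measurable fun p : S × X => P p.1 p.2 A)
    (hinv : ∀ s, π.bind (P s) = π)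
    (β : ℝ) (hβ : β < 1)
    (hA8 : ∀ s x y, tvDist (P s x) (P s y) ≤ β)
    {Ω : Type*} [mΩ : MeasurableSpace Ω] (μ : Measure Ω) [IsProbabilityMeasure μ]
    (F : Filtration ℕ mΩ) (sk : ℕ → S) (Xp : ℕ → Ω → X)
    (hadapted : ∀ k, Measurable[F k] (Xp k))
    (hmarkov : ∀ (k : ℕ) (A : Set X), MeasurableSet A →
      μ[fun ω => A.indicator (fun _ => (1 : ℝ)) (Xp (k + 1) ω) | F k]
        =ᵐ[μ] fun ω => (P (sk k) (Xp k ω) A).toReal)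
    (φ : X → ℝ) (hφm : Measurable φ) (hφb : ∃ B, ∀ x, |φ x| ≤ B) :
    TendstoInMeasure μ (fun n ω => (∑ k ∈ Finset.Icc 1 n,
        (gfun P π φ (sk k) (Xp k ω) - gfun P π φ (sk (k - 1)) (Xp k ω))) / n)
      atTop (fun _ => 0) ∧
    TendstoInMeasure μ (fun n ω => (∑ k ∈ Finset.Icc 1 n, φ (Xp k ω)) / n)
      atTop (fun _ => ∫ x, φ x ∂π) := by
  have : Nonempty X := Measure.nonempty_of_neZero π
  obtain ⟨B, hB⟩ := hφb
  have x0 : X := Classical.arbitrary X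
  have hβ0 : 0 ≤ β :=
    (Real.iSup_nonneg fun A => abs_nonneg _ : (0 : ℝ) ≤ tvDist (P (sk 0) x0) (P (sk 0) x0)).trans
      (hA8 (sk 0) x0 x0)
  have hP : ∀ s, Measurable (P s) := fun s =>
    Measure.measurable_of_measurable_coe _ fun A hA =>
      (hPmeas A hA).comp (measurable_const.prodMk measurable_id)
  have hφi : Integrable φ π := aux_integrable π hφm hB
  have hgood : Good π (2 * B) (fun y => φ y - ∫ z, φ z ∂π) := by
    refine aux_bd π (C := 2 * B) (hφm.sub_const _) (fun x => ?_) (fun x y => ?_) ?_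
    · have h1 := abs_le.1 (hB x)
      have h2 := abs_le.1 (aux_abs_integral_le π hB)
      rw [abs_le]; constructor <;> linarith
    · have h1 := abs_le.1 (hB x)
      have h2 := abs_le.1 (hB y)
      rw [abs_le]; constructor <;> linarith
    · rw [integral_sub hφi (integrable_const _)]; simp
  have hg := fun s => aux_gfun P s (hP s) (hPprob s) (hinv s) hβ0 hβ (hA8 s) hgood
  have key := aux_wlln (fun k => P (sk k)) π (fun k => hP _) (fun k => hPprob _)
    (fun k => hinv _) β hβ0 hβ (fun k => hA8 _) μ F Xp hadapted hmarkov
  constructor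
  · refine key (fun k x => gfun P π φ (sk k) x - gfun P π φ (sk (k - 1)) x)
      (4 * (2 * B * (1 - β)⁻¹)) (fun k => ?_)
    have hb := fun s x => abs_le.1 ((hg s).2.1 x)
    refine aux_bd π (C := 2 * (2 * B * (1 - β)⁻¹)) ((hg _).1.sub (hg _).1) (fun x => ?_)
      (fun x y => ?_) ?_
    · have h1 := hb (sk k) x
      have h2 := hb (sk (k - 1)) x
      rw [abs_le]; constructor <;> linarith
    · have h1 := hb (sk k) x
      have h2 := hb (sk (k - 1)) x
      have h3 := hb (sk k) y
      have h4 := hb (sk (k - 1)) y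
      rw [abs_le]; constructor <;> linarith
    · rw [integral_sub (aux_integrable π (hg _).1 (hg _).2.1)
        (aux_integrable π (hg _).1 (hg _).2.1), (hg _).2.2, (hg _).2.2, sub_zero]
  · have h := key (fun _ y => φ y - ∫ z, φ z ∂π) (2 * B) (fun _ => hgood)
    rw [tendstoInMeasure_iff_norm] at h ⊢
    intro ε hε
    refine (h ε hε).congr' ?_
    filter_upwards [eventually_gt_atTop 0] with n hn
    have hn' : (n : ℝ) ≠ 0 := by exact_mod_cast hn.ne'
    congr 1
    ext ω
    have : (∑ k ∈ Finset.Icc 1 n, (φ (Xp k ω) - ∫ z, φ z ∂π)) / (n : ℝ) - 0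
        = (∑ k ∈ Finset.Icc 1 n, φ (Xp k ω)) / (n : ℝ) - ∫ z, φ z ∂π := by
      rw [Finset.sum_sub_distrib]
      simp only [Finset.sum_const, Nat.card_Icc, nsmul_eq_mul, Nat.add_sub_cancel]
      field_simp
      ring
    simp only [Set.mem_ofPred_eq, this]
end
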